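/- arXiv:2402.07146 — 2 statements merged into one kernel-verified Lean document; each statement's English description precedes it below -/
import Mathlib

section
/- Multivariable Hua-type bound: fix a non-constant polynomial g ∈ F_q[t][y_1,…,y_n] with n ≥ 1. Then there exists A_g > 0 such that for every monic r ∈ F_q[t], the number N(g;r) of solutions (y_1,…,y_n) ∈ (F_q[t]/(r))^n to g ≡ 0 (mod r) satisfies N(g;r) ≤ A_g^{ω(r)} |r|^{n − 1/deg g}. -/
open scoped Classical

namespace HuaBound

open Polynomial

/-- If `p` is prime, `p ^ k ∣ a * b` and `p ^ (m + 1) ∤ b`, then `p ^ (k - m) ∣ a`. -/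
theorem pow_sub_dvd_of_pow_dvd_mul {R : Type*} [CommRing R] [IsDomain R] {p : R} (hp : Prime p)
    {a b : R} {k m : ℕ} (h : p ^ k ∣ a * b) (hb : ¬ p ^ (m + 1) ∣ b) : p ^ (k - m) ∣ a := by
  induction m generalizing b k with
  | zero =>
    rw [zero_add, pow_one] at hb
    simpa using hp.pow_dvd_of_dvd_mul_right k hb h
  | succ m ih =>
    by_cases hpb : p ∣ b
    · obtain ⟨c, rfl⟩ := hpb
      cases k with
      | zero => simp
      | succ k =>
        rw [Nat.succ_sub_succ]
        refine ih (b := c) ?_ fun hc => hb ?_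
        · rw [pow_succ', mul_left_comm] at h
          exact (mul_dvd_mul_iff_left hp.ne_zero).1 h
        · rw [pow_succ' p (m + 1)]
          exact mul_dvd_mul_left p hc
    · exact (pow_dvd_pow p (Nat.sub_le _ _)).trans (hp.pow_dvd_of_dvd_mul_right k hpb h)

/-- A polynomial of degree at most `d` divisible by `p ^ k` at `d + 1` points that are pairwise
incongruent modulo `p ^ (m + 1)` has its `d`-th coefficient divisible by `p ^ (k - d * m)`. -/
theorem pow_dvd_coeff_of_pow_dvd_eval {R : Type*} [CommRing R] [IsDomain R] {p : R} (hp : Prime p)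
    (m d : ℕ) (k : ℕ) (f : R[X]) (hf : f.natDegree ≤ d) (T : Finset R) (hT : d < T.card)
    (hdvd : ∀ x ∈ T, p ^ k ∣ f.eval x)
    (hsep : ∀ x ∈ T, ∀ y ∈ T, x ≠ y → ¬ p ^ (m + 1) ∣ x - y) :
    p ^ (k - d * m) ∣ f.coeff d := by
  induction d generalizing k f T with
  | zero =>
    obtain ⟨x, hx⟩ := Finset.card_pos.1 hT
    have h := hdvd x hx
    rw [eq_C_of_natDegree_le_zero hf, eval_C] at h
    simpa using h
  | succ d ih =>
    obtain ⟨x, hx⟩ := Finset.card_pos.1 ((Nat.zero_le _).trans_lt hT)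
    set h := f /ₘ (X - C x) with h_def
    have hdeg : h.natDegree ≤ d := by
      rw [h_def, natDegree_divByMonic _ (monic_X_sub_C x), natDegree_X_sub_C]
      omega
    have hcoeff : h.coeff d = f.coeff (d + 1) := by
      rw [h_def, coeff_divByMonic_X_sub_C_rec, ← h_def,
        coeff_eq_zero_of_natDegree_lt (Nat.lt_succ_of_le hdeg)]
      simp
    have hev (y : R) : h.eval y * (y - x) = f.eval y - f.eval x := by
      have := congrArg (eval y) (modByMonic_add_div f (X - C x))
      rw [modByMonic_X_sub_C_eq_C_eval] at this
      simp only [eval_add, eval_mul, eval_sub, eval_X, eval_C] at this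
      rw [← this, h_def]
      ring
    have := ih (k - m) h hdeg (T.erase x) (by rw [Finset.card_erase_of_mem hx]; omega)
      (fun y hy => by
        obtain ⟨hyx, hy⟩ := Finset.mem_erase.1 hy
        refine pow_sub_dvd_of_pow_dvd_mul hp (b := y - x) ?_ (hsep y hy x hx hyx)
        rw [hev]
        exact dvd_sub (hdvd y hy) (hdvd x hx))
      (fun y hy z hz => hsep y (Finset.mem_of_mem_erase hy) z (Finset.mem_of_mem_erase hz))
    rw [hcoeff] at this
    rwa [Nat.sub_sub, show m + d * m = (d + 1) * m by ring] at this

section Line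

variable {R σ : Type*} [CommRing R]

theorem exists_eval_homogeneousComponent_totalDegree_ne_zero [IsDomain R] [Infinite R]
    {g : MvPolynomial σ R} (hg : g ≠ 0) :
    ∃ u : σ → R, MvPolynomial.eval u (MvPolynomial.homogeneousComponent g.totalDegree g) ≠ 0 := by
  by_contra! h
  have h0 : MvPolynomial.homogeneousComponent g.totalDegree g = 0 :=
    MvPolynomial.funext fun u => by rw [h u, map_zero]
  obtain ⟨m, hm, hmd⟩ := Finset.exists_mem_eq_sup g.support (MvPolynomial.support_nonempty.2 hg)
    fun m => m.sum fun _ e => e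
  have := congrArg (MvPolynomial.coeff m) h0
  rw [MvPolynomial.coeff_homogeneousComponent, if_pos, MvPolynomial.coeff_zero] at this
  · exact MvPolynomial.mem_support_iff.1 hm this
  · exact hmd.symm

theorem natDegree_prod_linear_pow_le_and_coeff (s : Finset σ) (m : σ → ℕ) (y u : σ → R) :
    (∏ i ∈ s, (C (y i) + C (u i) * X) ^ m i).natDegree ≤ ∑ i ∈ s, m i ∧
      (∏ i ∈ s, (C (y i) + C (u i) * X) ^ m i).coeff (∑ i ∈ s, m i) = ∏ i ∈ s, u i ^ m i := by
  have hlin (i : σ) : (C (y i) + C (u i) * X).natDegree ≤ 1 := by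
    rw [add_comm]
    exact natDegree_linear_le
  have hpow (i : σ) : ((C (y i) + C (u i) * X) ^ m i).natDegree ≤ m i := by
    simpa using natDegree_pow_le_of_le (m i) (hlin i)
  induction s using Finset.induction_on with
  | empty => simp
  | insert i s hi ih =>
    simp only [Finset.prod_insert hi, Finset.sum_insert hi]
    refine ⟨natDegree_mul_le_of_le (hpow i) ih.1, ?_⟩
    rw [coeff_mul_add_eq_of_natDegree_le (hpow i) ih.1, ih.2]
    have := coeff_pow_of_natDegree_le (m := m i) (hlin i)
    rw [mul_one] at this
    rw [this]
    simp

variable [Fintype σ]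

/-- The restriction of `g` to the line through `y` with direction `u`. -/
noncomputable def lineRestrict (g : MvPolynomial σ R) (y u : σ → R) : R[X] :=
  MvPolynomial.eval₂ C (fun i => C (y i) + C (u i) * X) g

theorem eval_lineRestrict (g : MvPolynomial σ R) (y u : σ → R) (s : R) :
    (lineRestrict g y u).eval s = MvPolynomial.eval (fun i => y i + u i * s) g := by
  rw [lineRestrict, MvPolynomial.eval₂_eq', eval_finsetSum, MvPolynomial.eval_eq']
  simp [eval_prod]

theorem natDegree_lineRestrict_le (g : MvPolynomial σ R) (y u : σ → R) :
    (lineRestrict g y u).natDegree ≤ g.totalDegree := by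
  rw [lineRestrict, MvPolynomial.eval₂_eq']
  refine natDegree_sum_le_of_forall_le _ _ fun m hm => ?_
  refine (natDegree_C_mul_le _ _).trans
    ((natDegree_prod_linear_pow_le_and_coeff Finset.univ m y u).1.trans ?_)
  have := MvPolynomial.le_totalDegree hm
  rwa [Finsupp.sum_fintype _ _ fun _ => rfl] at this

theorem coeff_lineRestrict (g : MvPolynomial σ R) (y u : σ → R) :
    (lineRestrict g y u).coeff g.totalDegree =
      MvPolynomial.eval u (MvPolynomial.homogeneousComponent g.totalDegree g) := by
  rw [lineRestrict, MvPolynomial.eval₂_eq', MvPolynomial.homogeneousComponent_apply, map_sum,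
    finsetSum_coeff, Finset.sum_filter]
  refine Finset.sum_congr rfl fun m hm => ?_
  obtain ⟨h1, h2⟩ := natDegree_prod_linear_pow_le_and_coeff Finset.univ m y u
  have hle := MvPolynomial.le_totalDegree hm
  rw [Finsupp.sum_fintype _ _ fun _ => rfl] at hle
  rw [coeff_C_mul, Finsupp.degree_eq_sum]
  split_ifs with h
  · rw [← h, h2, MvPolynomial.eval_monomial, Finsupp.prod_fintype _ _ fun _ => pow_zero _]
  · rw [coeff_eq_zero_of_natDegree_lt (lt_of_le_of_lt h1 (lt_of_le_of_ne hle h)), mul_zero]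

end Line

section Count

variable {K : Type*} [Field K]

theorem dvd_mod_sub (r x : K[X]) : r ∣ x % r - x :=
  ⟨-(x / r), by linear_combination EuclideanDomain.mod_add_div x r⟩

theorem dvd_sub_of_mod_eq {r x y : K[X]} (h : x % r = y % r) : r ∣ x - y := by
  have := dvd_sub (dvd_mod_sub r y) (dvd_mod_sub r x)
  rwa [h, sub_sub_sub_cancel_left] at this

theorem dvd_eval_mod {f : K[X][X]} {r x : K[X]} (h : r ∣ f.eval x) : r ∣ f.eval (x % r) :=
  (dvd_sub_left h).1 ((dvd_mod_sub r x).trans (sub_dvd_eval_sub _ _ f))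

/-- The monic irreducible divisors of `r`. -/
def primeDivisors (r : K[X]) : Set K[X] := {p | p.Monic ∧ Irreducible p ∧ p ∣ r}

theorem finite_primeDivisors {r : K[X]} (hr : r ≠ 0) : (primeDivisors r).Finite := by
  refine (UniqueFactorizationMonoid.normalizedFactors r).toFinset.finite_toSet.subset ?_
  rintro p ⟨hm, hi, hd⟩
  rw [Finset.mem_coe, Multiset.mem_toFinset,
    UniqueFactorizationMonoid.mem_normalizedFactors_iff' hr]
  exact ⟨hi, hm.normalize_eq_self, hd⟩

theorem ncard_primeDivisors_mul {a b : K[X]} (ha : a ≠ 0) (hb : b ≠ 0) (hab : IsCoprime a b) :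
    (primeDivisors (a * b)).ncard = (primeDivisors a).ncard + (primeDivisors b).ncard := by
  rw [← Set.ncard_union_eq ?_ (finite_primeDivisors ha) (finite_primeDivisors hb)]
  · congr 1
    ext p
    constructor
    · rintro ⟨hm, hi, hd⟩
      exact (hi.prime.dvd_or_dvd hd).imp (fun h => ⟨hm, hi, h⟩) fun h => ⟨hm, hi, h⟩
    · rintro (⟨hm, hi, hd⟩ | ⟨hm, hi, hd⟩)
      · exact ⟨hm, hi, hd.mul_right b⟩
      · exact ⟨hm, hi, hd.mul_left a⟩
  · rw [Set.disjoint_left]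
    rintro p ⟨-, hi, hda⟩ ⟨-, -, hdb⟩
    exact hi.not_isUnit (hab.isUnit_of_dvd' hda hdb)

theorem ncard_primeDivisors_pos {r : K[X]} (hr : r ≠ 0) (hu : ¬ IsUnit r) :
    0 < (primeDivisors r).ncard := by
  rw [Set.ncard_pos (finite_primeDivisors hr)]
  obtain ⟨p, hm, hi, hd⟩ := exists_monic_irreducible_factor r hu
  exact ⟨p, hm, hi, hd⟩

theorem finite_setOf_degree_lt [Finite K] (N : ℕ) : {x : K[X] | x.degree < N}.Finite := by
  have : Finite (degreeLT K N) := Finite.of_equiv _ (degreeLTEquiv K N).toEquiv.symm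
  refine (Set.toFinite (degreeLT K N : Set K[X])).subset fun x hx => mem_degreeLT.2 hx

variable [Fintype K]

/-- The polynomials of degree less than `N`. -/
noncomputable def box (K : Type*) [Field K] [Fintype K] (N : ℕ) : Finset K[X] :=
  (finite_setOf_degree_lt N).toFinset

theorem mem_box {N : ℕ} {x : K[X]} : x ∈ box K N ↔ x.degree < N := by
  simp [box]

theorem card_box (N : ℕ) : (box K N).card = Fintype.card K ^ N := by
  rw [← Set.ncard_coe_finset, ← Nat.card_coe_set_eq,
    Nat.card_congr ((Equiv.subtypeEquivRight fun x => by
      rw [Finset.mem_coe, mem_box, mem_degreeLT]).trans (degreeLTEquiv K N).toEquiv)]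
  simp

theorem mod_mem_box (x : K[X]) {r : K[X]} (hr : r ≠ 0) : x % r ∈ box K r.natDegree := by
  rw [mem_box, ← degree_eq_natDegree hr]
  exact degree_mod_lt x hr

theorem eq_of_dvd_sub_of_mem_box {r x y : K[X]} (hr : r ≠ 0) (hx : x ∈ box K r.natDegree)
    (hy : y ∈ box K r.natDegree) (h : r ∣ x - y) : x = y := by
  rw [mem_box, ← degree_eq_natDegree hr] at hx hy
  exact sub_eq_zero.1 (eq_zero_of_dvd_of_degree_lt h
    ((degree_sub_le x y).trans_lt (max_lt hx hy)))

theorem mod_eq_mod_of_dvd_sub {r x y : K[X]} (hr : r ≠ 0) (h : r ∣ x - y) : x % r = y % r := by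
  refine eq_of_dvd_sub_of_mem_box hr (mod_mem_box x hr) (mod_mem_box y hr) ?_
  have := dvd_add (dvd_sub (dvd_mod_sub r x) (dvd_mod_sub r y)) h
  rwa [sub_sub_sub_comm, sub_add_cancel] at this

theorem div_mem_box {r x : K[X]} {N M : ℕ} (hr : r ≠ 0) (hN : N ≤ r.natDegree + M)
    (hx : x ∈ box K N) : x / r ∈ box K M := by
  rw [mem_box] at hx ⊢
  by_cases h : x / r = 0
  · rw [h, degree_zero]
    exact WithBot.bot_lt_coe M
  · have hle : r.degree ≤ x.degree := by
      by_contra! hlt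
      exact h ((Polynomial.div_eq_zero_iff hr).2 hlt)
    have hadd := degree_add_div hr hle
    have hx0 : x ≠ 0 := by
      rintro rfl
      exact h EuclideanDomain.zero_div
    rw [degree_eq_natDegree hr, degree_eq_natDegree h, degree_eq_natDegree hx0] at hadd
    rw [degree_eq_natDegree hx0] at hx
    rw [degree_eq_natDegree h]
    norm_cast at *
    omega

/-- The solutions of `f ≡ 0` modulo `r`, as polynomials of degree less than that of `r`. -/
noncomputable def rootsMod (f : K[X][X]) (r : K[X]) : Finset K[X] :=
  {x ∈ box K r.natDegree | r ∣ f.eval x}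

theorem mem_rootsMod {f : K[X][X]} {r x : K[X]} :
    x ∈ rootsMod f r ↔ x ∈ box K r.natDegree ∧ r ∣ f.eval x := by
  simp [rootsMod]

theorem card_rootsMod_mul_le (f : K[X][X]) {a b : K[X]} (ha : a ≠ 0) (hb : b ≠ 0)
    (hab : IsCoprime a b) :
    (rootsMod f (a * b)).card ≤ (rootsMod f a).card * (rootsMod f b).card := by
  rw [← Finset.card_product]
  refine Finset.card_le_card_of_injOn (fun x => (x % a, x % b)) (fun x hx => ?_) ?_
  · obtain ⟨-, hx⟩ := mem_rootsMod.1 hx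
    simp only [Finset.coe_product, Set.mem_prod, Finset.mem_coe, mem_rootsMod]
    exact ⟨⟨mod_mem_box x ha, dvd_eval_mod ((dvd_mul_right a b).trans hx)⟩,
      ⟨mod_mem_box x hb, dvd_eval_mod ((dvd_mul_left b a).trans hx)⟩⟩
  · intro x hx y hy hxy
    obtain ⟨h1, h2⟩ := Prod.mk.inj hxy
    refine eq_of_dvd_sub_of_mem_box (mul_ne_zero ha hb) (mem_rootsMod.1 hx).1
      (mem_rootsMod.1 hy).1 (hab.mul_dvd ?_ ?_)
    · exact dvd_sub_of_mod_eq h1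
    · exact dvd_sub_of_mod_eq h2

theorem card_rootsMod_pow_le (f : K[X][X]) {p : K[X]} (hp : Prime p) {d k c m : ℕ}
    (hf : f.natDegree ≤ d) (hc : ¬ p ^ (c + 1) ∣ f.coeff d) (hm : d * m + c < k)
    (hmk : m < k) :
    (rootsMod f (p ^ k)).card ≤ d * Fintype.card K ^ ((k - (m + 1)) * p.natDegree) := by
  set P := p ^ (m + 1) with hP
  have hP0 : P ≠ 0 := pow_ne_zero _ hp.ne_zero
  have himg : ((rootsMod f (p ^ k)).image (· % P)).card ≤ d := by
    by_contra! hcard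
    obtain ⟨T, hT, hinj, himg⟩ := Finset.exists_subset_injOn_image_eq_of_surjOn (f := (· % P))
      (rootsMod f (p ^ k) : Set K[X]) ((rootsMod f (p ^ k)).image (· % P))
      (by rw [Finset.coe_image]; exact Set.surjOn_image _ _)
    refine hc ((pow_dvd_pow p (by omega)).trans
      (pow_dvd_coeff_of_pow_dvd_eval hp m d k f hf T ?_ ?_ ?_))
    · rwa [← himg, Finset.card_image_of_injOn hinj] at hcard
    · exact fun x hx => (mem_rootsMod.1 (hT hx)).2
    · exact fun x hx y hy hxy hdvd => hxy (hinj hx hy (mod_eq_mod_of_dvd_sub hP0 hdvd))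
  have hsub : (rootsMod f (p ^ k)).card ≤ (((rootsMod f (p ^ k)).image (· % P)) ×ˢ
      box K ((k - (m + 1)) * p.natDegree)).card := by
    refine Finset.card_le_card_of_injOn (fun x => (x % P, x / P)) (fun x hx => ?_) ?_
    · simp only [Finset.coe_product, Set.mem_prod, Finset.mem_coe]
      refine ⟨Finset.mem_image_of_mem _ hx, ?_⟩
      refine div_mem_box hP0 ?_ (mem_rootsMod.1 hx).1
      rw [hP, natDegree_pow, natDegree_pow, ← add_mul, Nat.add_sub_cancel' hmk]
    · intro x _ y _ hxy
      obtain ⟨h1, h2⟩ := Prod.mk.inj hxy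
      rw [← EuclideanDomain.mod_add_div x P, h1, h2, EuclideanDomain.mod_add_div]
  rw [Finset.card_product, card_box] at hsub
  exact hsub.trans (Nat.mul_le_mul_right _ himg)

theorem card_rootsMod_le (f : K[X][X]) (r : K[X]) :
    (rootsMod f r).card ≤ Fintype.card K ^ r.natDegree := by
  rw [← card_box]
  exact Finset.card_filter_le _ _

theorem card_rootsMod_prime_pow_pow_le {f : K[X][X]} {d : ℕ} (hd : d ≠ 0)
    (hf : f.natDegree ≤ d) (ha : f.coeff d ≠ 0) {p : K[X]} (hp : Prime p) (k : ℕ) :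
    ∃ e, e ∣ f.coeff d ∧ e ∣ p ^ k ∧
      (rootsMod f (p ^ k)).card ^ d * Fintype.card K ^ (p ^ k).natDegree ≤
        d ^ ((primeDivisors (p ^ k)).ncard * d) *
          (Fintype.card K ^ ((p ^ k).natDegree * d) * Fintype.card K ^ e.natDegree) := by
  have hq : 0 < Fintype.card K := Fintype.card_pos
  have hfin : FiniteMultiplicity p (f.coeff d) := FiniteMultiplicity.of_prime_left hp ha
  set c := multiplicity p (f.coeff d)
  have hcdvd : p ^ c ∣ f.coeff d := pow_multiplicity_dvd _ _
  have hcn : ¬ p ^ (c + 1) ∣ f.coeff d := hfin.not_pow_dvd_of_multiplicity_lt (Nat.lt_succ_self _)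
  rcases le_or_gt k c with hkc | hck
  · refine ⟨p ^ k, (pow_dvd_pow p hkc).trans hcdvd, dvd_rfl, ?_⟩
    rw [← mul_assoc]
    refine Nat.mul_le_mul_right _ ?_
    rw [pow_mul (Fintype.card K)]
    exact (Nat.pow_le_pow_left (card_rootsMod_le f _) d).trans
      (Nat.le_mul_of_pos_left _ (by positivity))
  · refine ⟨p ^ c, hcdvd, pow_dvd_pow p hck.le, ?_⟩
    set m := (k - c - 1) / d with hm
    have h1 : d * m ≤ k - c - 1 := Nat.mul_div_le _ _
    have h2 : k - c - 1 < d * (m + 1) := by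
      rw [mul_comm]
      exact Nat.lt_mul_of_div_lt (Nat.lt_succ_self _) (Nat.pos_of_ne_zero hd)
    have h3 : m ≤ k - c - 1 := Nat.div_le_self _ _
    have hω : 1 ≤ (primeDivisors (p ^ k)).ncard :=
      ncard_primeDivisors_pos (pow_ne_zero k hp.ne_zero)
        fun h => hp.not_isUnit ((isUnit_pow_iff (by omega)).1 h)
    calc _ ≤ (d * Fintype.card K ^ ((k - (m + 1)) * p.natDegree)) ^ d *
          Fintype.card K ^ (p ^ k).natDegree :=
          Nat.mul_le_mul_right _ (Nat.pow_le_pow_left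
            (card_rootsMod_pow_le f hp hf hcn (m := m) (by omega) (by omega)) d)
      _ = d ^ (1 * d) *
          Fintype.card K ^ (((k - (m + 1)) * d + k) * p.natDegree) := by
          rw [natDegree_pow]
          ring
      _ ≤ d ^ (1 * d) * Fintype.card K ^ ((k * d + c) * p.natDegree) := by
          refine Nat.mul_le_mul_left _ (Nat.pow_le_pow_right hq (Nat.mul_le_mul_right _ ?_))
          have h4 : k * d = (k - (m + 1)) * d + d * (m + 1) := by
            rw [mul_comm d, ← add_mul, Nat.sub_add_cancel (by omega)]
          omega
      _ ≤ d ^ ((primeDivisors (p ^ k)).ncard * d) *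
          Fintype.card K ^ ((k * d + c) * p.natDegree) :=
          Nat.mul_le_mul_right _ (Nat.pow_le_pow_right (Nat.pos_of_ne_zero hd)
            (Nat.mul_le_mul_right _ hω))
      _ = _ := by
          rw [natDegree_pow, natDegree_pow, ← pow_add]
          ring_nf

/-- Hua's bound for a polynomial in one variable, raised to the power `d` so as to avoid
fractional exponents; the factor involving `e` accounts for the primes at which the `d`-th
coefficient is not a unit. -/
theorem card_rootsMod_pow_le_of_coeff_ne_zero {f : K[X][X]} {d : ℕ} (hd : d ≠ 0)
    (hf : f.natDegree ≤ d) (ha : f.coeff d ≠ 0) {r : K[X]} (hr : r ≠ 0) :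
    ∃ e, e ∣ f.coeff d ∧ e ∣ r ∧
      (rootsMod f r).card ^ d * Fintype.card K ^ r.natDegree ≤
        d ^ ((primeDivisors r).ncard * d) *
          (Fintype.card K ^ (r.natDegree * d) * Fintype.card K ^ e.natDegree) := by
  revert hr
  refine UniqueFactorizationMonoid.induction_on_coprime r (fun h => absurd rfl h) ?_
    (fun k hp _ => card_rootsMod_prime_pow_pow_le hd hf ha hp k) ?_
  · intro x hx _
    refine ⟨1, one_dvd _, one_dvd _, ?_⟩
    have h0 : x.natDegree = 0 := natDegree_eq_zero_of_isUnit hx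
    have hc := card_rootsMod_le f x
    rw [h0, pow_zero] at hc
    simp only [h0, pow_zero, zero_mul, natDegree_one, mul_one]
    exact (pow_le_one₀ (Nat.zero_le _) hc).trans (Nat.one_le_pow _ _ (Nat.pos_of_ne_zero hd))
  · intro x y hxy ihx ihy hne
    obtain ⟨hx, hy⟩ := mul_ne_zero_iff.1 hne
    have hxy := hxy.isCoprime
    obtain ⟨e₁, h1a, h1r, h1⟩ := ihx hx
    obtain ⟨e₂, h2a, h2r, h2⟩ := ihy hy
    refine ⟨e₁ * e₂, (hxy.mono h1r h2r).mul_dvd h1a h2a, mul_dvd_mul h1r h2r, ?_⟩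
    rw [natDegree_mul hx hy, natDegree_mul (ne_zero_of_dvd_ne_zero hx h1r)
      (ne_zero_of_dvd_ne_zero hy h2r), ncard_primeDivisors_mul hx hy hxy]
    calc _ ≤ ((rootsMod f x).card * (rootsMod f y).card) ^ d *
          Fintype.card K ^ (x.natDegree + y.natDegree) :=
          Nat.mul_le_mul_right _ (Nat.pow_le_pow_left (card_rootsMod_mul_le f hx hy hxy) d)
      _ = _ := by rw [mul_pow, pow_add, mul_mul_mul_comm]
      _ ≤ _ := Nat.mul_le_mul h1 h2
      _ = _ := by ring

end Count

section Averaging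

theorem dvd_eval_sub_eval {R σ : Type*} [CommRing R] [Fintype σ] {r : R} {x y : σ → R}
    (h : ∀ i, r ∣ x i - y i) (g : MvPolynomial σ R) :
    r ∣ MvPolynomial.eval x g - MvPolynomial.eval y g := by
  simp only [← Ideal.mem_span_singleton, ← Ideal.Quotient.eq] at h ⊢
  simp only [MvPolynomial.eval_eq', map_sum, map_mul, map_prod, map_pow, h]

variable {K σ : Type*} [Field K] [Fintype K] [Fintype σ] [DecidableEq σ]

/-- The solutions of `g ≡ 0` modulo `r`, as tuples of polynomials of degree less than that
of `r`. -/
noncomputable def zerosMod (g : MvPolynomial σ K[X]) (r : K[X]) : Finset (σ → K[X]) :=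
  {y ∈ Fintype.piFinset fun _ => box K r.natDegree | r ∣ MvPolynomial.eval y g}

theorem mem_zerosMod {g : MvPolynomial σ K[X]} {r : K[X]} {y : σ → K[X]} :
    y ∈ zerosMod g r ↔ (∀ i, y i ∈ box K r.natDegree) ∧ r ∣ MvPolynomial.eval y g := by
  simp [zerosMod]

theorem card_box_mul_card_zerosMod_le (g : MvPolynomial σ K[X]) (u : σ → K[X]) {r : K[X]}
    (hr : r ≠ 0) :
    (box K r.natDegree).card * (zerosMod g r).card ≤
      ∑ y ∈ Fintype.piFinset fun _ => box K r.natDegree,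
        (rootsMod (lineRestrict g y u) r).card := by
  rw [← Finset.card_product, ← Finset.card_sigma]
  refine Finset.card_le_card_of_injOn
    (fun z => ⟨fun i => (z.2 i - u i * z.1) % r, z.1⟩) (fun z hz => ?_) ?_
  · obtain ⟨hs, hz⟩ := Finset.mem_product.1 hz
    rw [Finset.mem_coe, Finset.mem_sigma, Fintype.mem_piFinset, mem_rootsMod, eval_lineRestrict]
    refine ⟨fun i => mod_mem_box _ hr, hs, ?_⟩
    refine (dvd_sub_left (mem_zerosMod.1 hz).2).1 (dvd_eval_sub_eval (fun i => ?_) g)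
    have := dvd_mod_sub r (z.2 i - u i * z.1)
    rwa [← sub_add, sub_add_eq_add_sub] at this
  · rintro ⟨s, z⟩ hz ⟨s', z'⟩ hz' h
    simp only [Sigma.mk.injEq, heq_eq_eq] at h
    obtain ⟨h, rfl⟩ := h
    have hz := mem_zerosMod.1 (Finset.mem_product.1 hz).2
    have hz' := mem_zerosMod.1 (Finset.mem_product.1 hz').2
    refine Prod.ext rfl (funext fun i => eq_of_dvd_sub_of_mem_box hr (hz.1 i) (hz'.1 i) ?_)
    have := dvd_sub_of_mod_eq (congrFun h i)
    rwa [sub_sub_sub_cancel_right] at this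

end Averaging

theorem le_mul_rpow_of_pow_mul_le {d w c : ℕ} (hd : d ≠ 0) {Q E : ℝ} (hQ : 0 < Q) (hE : 0 ≤ E)
    (h : (c : ℝ) ^ d * Q ≤ (d : ℝ) ^ (w * d) * (Q ^ d * E)) :
    (c : ℝ) ≤ (d : ℝ) ^ w * E ^ (1 / d : ℝ) * Q ^ (1 - 1 / d : ℝ) := by
  have hd' : (d : ℝ) ≠ 0 := Nat.cast_ne_zero.2 hd
  refine le_of_pow_le_pow_left₀ hd (by positivity) ?_
  refine le_of_mul_le_mul_right (h.trans_eq ?_) hQ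
  have h1 : (E ^ (1 / d : ℝ)) ^ d = E := by
    rw [one_div, Real.rpow_inv_natCast_pow hE hd]
  have h2 : (Q ^ (1 - 1 / d : ℝ)) ^ d * Q = Q ^ d := by
    rw [← Real.rpow_mul_natCast hQ.le, sub_mul, one_mul, one_div_mul_cancel hd',
      Real.rpow_sub_one hQ.ne', Real.rpow_natCast, div_mul_cancel₀ _ hQ.ne']
  rw [mul_pow, mul_pow, h1, mul_assoc, h2, pow_mul]
  ring

end HuaBound

/-- multivariable Hua-type bound: for a fixed non-constant polynomial
`g ∈ F_q[t][y₁,…,yₙ]` there is `A_g > 0` such that for every monic `r ∈ F_q[t]`, the number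
`N(g;r)` of solutions `y mod r` of `g(y) ≡ 0 (mod r)` satisfies
`N(g;r) ≤ A_g^{ω(r)} |r|^{n - 1/deg g}`. -/
theorem multivariable_hua_bound (Fq : Type*) [Field Fq] [Fintype Fq] (n : ℕ) (hn : 1 ≤ n)
    (g : MvPolynomial (Fin n) (Polynomial Fq)) (hg : 1 ≤ g.totalDegree) :
    ∃ A : ℝ, 0 < A ∧
      ∀ r : Polynomial Fq, r.Monic →
        (Set.ncard {y : Fin n → Polynomial Fq |
            (∀ i, (y i).degree < r.degree) ∧ r ∣ MvPolynomial.eval y g} : ℝ) ≤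
          A ^ (Set.ncard {p : Polynomial Fq | p.Monic ∧ Irreducible p ∧ p ∣ r}) *
            ((Fintype.card Fq : ℝ) ^ r.natDegree) ^ ((n : ℝ) - 1 / g.totalDegree) := by
  have hg0 : g ≠ 0 := by
    rintro rfl
    simp at hg
  set d := g.totalDegree with hd_def
  have hd : d ≠ 0 := by omega
  have hd1 : (1 : ℝ) ≤ d := by exact_mod_cast hg
  obtain ⟨u, hu⟩ := HuaBound.exists_eval_homogeneousComponent_totalDegree_ne_zero hg0
  set a := MvPolynomial.eval u (MvPolynomial.homogeneousComponent g.totalDegree g)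
  have hq : (1 : ℝ) ≤ Fintype.card Fq := by exact_mod_cast Fintype.card_pos (α := Fq)
  set q : ℝ := (Fintype.card Fq : ℝ) with hq_def
  have hB : 1 ≤ (q ^ a.natDegree) ^ (1 / d : ℝ) :=
    Real.one_le_rpow (one_le_pow₀ hq) (by positivity)
  refine ⟨d * (q ^ a.natDegree) ^ (1 / d : ℝ), by positivity, fun r hr => ?_⟩
  have hr0 := hr.ne_zero
  have hset : {y : Fin n → Polynomial Fq |
      (∀ i, (y i).degree < r.degree) ∧ r ∣ MvPolynomial.eval y g} = HuaBound.zerosMod g r := by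
    ext y
    rw [Finset.mem_coe, HuaBound.mem_zerosMod, Polynomial.degree_eq_natDegree hr0]
    simp only [HuaBound.mem_box, Set.mem_ofPred_eq]
  rw [hset, Set.ncard_coe_finset]
  change _ ≤ _ ^ (HuaBound.primeDivisors r).ncard * _
  set w := (HuaBound.primeDivisors r).ncard with hw
  set Q : ℝ := q ^ r.natDegree with hQ_def
  have hQ : 0 < Q := by positivity
  have hline (y : Fin n → Polynomial Fq) :
      ((HuaBound.rootsMod (HuaBound.lineRestrict g y u) r).card : ℝ) ≤
        (d * (q ^ a.natDegree) ^ (1 / d : ℝ)) ^ w * Q ^ (1 - 1 / d : ℝ) := by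
    have hcoeff := HuaBound.coeff_lineRestrict g y u
    obtain ⟨e, hea, her, he⟩ := HuaBound.card_rootsMod_pow_le_of_coeff_ne_zero hd
      (HuaBound.natDegree_lineRestrict_le g y u) (by rw [hcoeff]; exact hu) hr0
    rw [hcoeff] at hea
    refine (HuaBound.le_mul_rpow_of_pow_mul_le hd hQ (E := q ^ e.natDegree) (w := w)
      (by positivity) ?_).trans ?_
    · rw [hQ_def, ← pow_mul, hq_def, hw]
      exact_mod_cast he
    · rw [mul_pow]
      gcongr
      rcases Nat.eq_zero_or_pos w with h0 | hpos
      · have hunit : IsUnit r := by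
          by_contra hr
          exact (HuaBound.ncard_primeDivisors_pos hr0 hr).ne' h0
        rw [Polynomial.natDegree_eq_zero_of_isUnit (isUnit_of_dvd_unit her hunit), h0]
        simp
      · refine le_trans ?_ (le_self_pow₀ hB hpos.ne')
        gcongr
        exact Polynomial.natDegree_le_of_dvd hea hu
  have havg := HuaBound.card_box_mul_card_zerosMod_le g u hr0
  have hsum : Q * (HuaBound.zerosMod g r).card ≤
      Q ^ n * ((d * (q ^ a.natDegree) ^ (1 / d : ℝ)) ^ w * Q ^ (1 - 1 / d : ℝ)) := by
    calc Q * ((HuaBound.zerosMod g r).card : ℝ)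
        ≤ ∑ y ∈ Fintype.piFinset fun _ => HuaBound.box Fq r.natDegree,
          ((HuaBound.rootsMod (HuaBound.lineRestrict g y u) r).card : ℝ) := by
          rw [HuaBound.card_box] at havg
          rw [hQ_def, hq_def]
          exact_mod_cast havg
      _ ≤ _ := Finset.sum_le_card_nsmul _ _ _ fun y _ => hline y
      _ = _ := by
          rw [nsmul_eq_mul, Fintype.card_piFinset_const, HuaBound.card_box]
          simp [hQ_def, hq_def]
  refine le_of_mul_le_mul_left (hsum.trans_eq ?_) hQ
  rw [mul_left_comm, mul_left_comm Q, ← Real.rpow_natCast Q n, ← Real.rpow_add hQ,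
    ← Real.rpow_one_add' hQ.le]
  · congr 2
    ring
  · have h1 : (1 : ℝ) ≤ n := by exact_mod_cast hn
    have h2 : 1 / (d : ℝ) ≤ 1 := by
      rw [div_le_one (by positivity)]
      exact hd1
    linarith
end

section
/- Geometric sieve over F_q[t] (Ekedahl sieve, square-free moduli): let T, Y > 0 and fix H_0, H_1 ∈ F_q[t][c_1,…,c_n] relatively prime in F_q(t)[c_1,…,c_n]. Then the number of c ∈ F_q[t]^n with max_i |c_i| ≤ q^T such that there exists a monic square-free r ∈ F_q[t] with |r| = q^Y dividing gcd(H_0(c), H_1(c)) is O_ε(q^{Yε}(q^{nT − Y} + q^{(n−1)T})). -/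
open scoped Classical

noncomputable section

/-- `|x| = q^{deg x}` on `F_q[t]`, with `|0| = 0`. -/
def polyAbs (Fq : Type*) [Field Fq] [Fintype Fq] (x : Polynomial Fq) : ℝ :=
  if x = 0 then 0 else (Fintype.card Fq : ℝ) ^ x.natDegree

namespace EkedahlSieve

open Polynomial UniqueFactorizationMonoid

section OneVariable

variable {F : Type*} [Field F]

/-- The prime factors of `f` multiply up to a divisor of `f`, so their degrees add up to at most
the degree of `f`. -/
lemma sum_natDegree_primeFactors_le {f : F[X]} (hf : f ≠ 0) :
    ∑ p ∈ primeFactors f, p.natDegree ≤ f.natDegree := by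
  have h := natDegree_le_of_dvd (radical_dvd_self (a := f)) hf
  rwa [radical, natDegree_prod] at h
  intro p hp
  rw [mem_primeFactors] at hp
  exact (prime_of_normalized_factor p hp).ne_zero

lemma radical_eq_self {r : F[X]} (hr : r.Monic) (hs : Squarefree r) : radical r = r := by
  have h1 := radical_associated hs.isRadical hr.ne_zero
  refine eq_of_monic_of_associated ?_ hr h1
  refine monic_prod_of_monic _ _ fun p hp => ?_
  have h2 := (mem_normalizedFactors_iff' hr.ne_zero).1 (mem_primeFactors.1 hp)
  rw [id, ← h2.2.1]
  exact Polynomial.monic_normalize h2.1.ne_zero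

lemma primeFactors_prod_dvd {r u : F[X]} {P : Finset F[X]} (hP : P ⊆ primeFactors r)
    (h : ∀ p ∈ P, p ∣ u) : ∏ p ∈ P, p ∣ u :=
  Finset.prod_dvd_of_isRelPrime
    (fun _ hx _ hy hxy => pairwise_primeFactors_isRelPrime (hP hx) (hP hy) hxy) h

lemma card_squarefree_divisors_le {f : F[X]} (hf : f ≠ 0) (S : Finset F[X])
    (hS : ∀ r ∈ S, r.Monic ∧ Squarefree r ∧ r ∣ f) :
    S.card ≤ 2 ^ (primeFactors f).card := by
  rw [← Finset.card_powerset]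
  refine Finset.card_le_card_of_injOn primeFactors (fun r hr => ?_) fun r hr s hs h => ?_
  · have h1 := hS r hr
    have := (radical_dvd_iff_primeFactors_subset (a := r) hf).1 ((radical_dvd_self).trans h1.2.2)
    simpa using this
  · have h1 := hS r hr
    have h2 := hS s hs
    rw [← radical_eq_self h1.1 h1.2.1, ← radical_eq_self h2.1 h2.2.1, radical, radical, h]

/-- The residues modulo a prime `p` of the elements on which `f` vanishes modulo `p`. -/
lemma card_image_mk_le {f : F[X][X]} {d : ℕ} (hd : f.natDegree ≤ d) {p : F[X]} (hp : Prime p)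
    (hu : ¬ p ∣ f.coeff d) (S : Finset F[X]) (hS : ∀ x ∈ S, p ∣ f.eval x) :
    (S.image (AdjoinRoot.mk p)).card ≤ d := by
  have : Fact (Irreducible p) := ⟨hp.irreducible⟩
  have hne : f.map (AdjoinRoot.mk p) ≠ 0 := by
    intro h
    apply hu
    rw [← AdjoinRoot.mk_eq_zero, ← coeff_map, h, coeff_zero]
  calc (S.image (AdjoinRoot.mk p)).card
      ≤ (f.map (AdjoinRoot.mk p)).roots.toFinset.card := by
        refine Finset.card_le_card fun y hy => ?_
        obtain ⟨x, hx, rfl⟩ := Finset.mem_image.1 hy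
        rw [Multiset.mem_toFinset, mem_roots hne, IsRoot.def, eval_map_apply,
          AdjoinRoot.mk_eq_zero]
        exact hS x hx
    _ ≤ (f.map (AdjoinRoot.mk p)).natDegree :=
        (Multiset.toFinset_card_le _).trans (card_roots' _)
    _ ≤ d := natDegree_map_le.trans hd

variable [Fintype F]

lemma finite_degreeLT (M : ℕ) : (degreeLT F M : Set F[X]).Finite := by
  have : Finite (degreeLT F M) := Finite.of_equiv _ (degreeLTEquiv F M).symm.toEquiv
  exact Set.toFinite _

/-- The polynomials of degree less than `M`. -/
def box (F : Type*) [Field F] [Fintype F] (M : ℕ) : Finset F[X] :=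
  (finite_degreeLT (F := F) M).toFinset

lemma mem_box {M : ℕ} {x : F[X]} : x ∈ box F M ↔ x.degree < M := by
  simp [box, mem_degreeLT]

lemma card_box (M : ℕ) : (box F M).card = Fintype.card F ^ M := by
  rw [box, ← Nat.card_eq_card_finite_toFinset]
  exact (Nat.card_congr (degreeLTEquiv F M).toEquiv).trans (by simp)

/-- A congruence class modulo `g` meets the box in at most `max(1, q^{M - deg g})` points. -/
lemma card_congr_le (M : ℕ) {g : F[X]} (hg : g ≠ 0) (S : Finset F[X]) (hS : S ⊆ box F M)
    (h : ∀ x ∈ S, ∀ y ∈ S, g ∣ x - y) : S.card ≤ Fintype.card F ^ (M - g.natDegree) := by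
  obtain rfl | ⟨y, hy⟩ := S.eq_empty_or_nonempty
  · simp
  rw [← card_box]
  refine Finset.card_le_card_of_injOn (fun x => (x - y) / g) (fun x hx => ?_)
    fun x hx x' hx' hxx => ?_
  · obtain ⟨k, hk⟩ := h x hx y hy
    have hlt : (x - y).degree < M :=
      (degree_sub_le _ _).trans_lt (max_lt (mem_box.1 (hS hx)) (mem_box.1 (hS hy)))
    simp only [Finset.mem_coe, mem_box]
    rw [hk, mul_div_cancel_left₀ _ hg]
    by_cases hk0 : k = 0
    · simp [hk0]
    rw [hk, degree_mul, degree_eq_natDegree hg, degree_eq_natDegree hk0] at hlt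
    rw [degree_eq_natDegree hk0]
    have : g.natDegree + k.natDegree < M := by exact_mod_cast hlt
    exact_mod_cast (by omega : k.natDegree < M - g.natDegree)
  · obtain ⟨k, hk⟩ := h x hx y hy
    obtain ⟨k', hk'⟩ := h x' hx' y hy
    simp only [hk, hk', mul_div_cancel_left₀ _ hg] at hxx
    rw [← sub_left_inj (a := y), hk, hk', hxx]

/-- The number of points of the box at which a polynomial with fixed leading coefficient is
divisible by the square-free `r`. -/
lemma card_dvd_eval_le {f : F[X][X]} {d : ℕ} (hd : f.natDegree ≤ d) (hu : f.coeff d ≠ 0)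
    {r : F[X]} (hr : r.Monic) (hs : Squarefree r) (M : ℕ) :
    ((box F M).filter fun x => r ∣ f.eval x).card ≤
      (d + 1) ^ (primeFactors r).card *
        Fintype.card F ^ ((f.coeff d).natDegree + (M - r.natDegree)) := by
  set u := f.coeff d
  set P := (primeFactors r).filter fun p => ¬ p ∣ u
  set Q := (primeFactors r).filter fun p => p ∣ u
  set S := (box F M).filter fun x => r ∣ f.eval x
  have hne : ∀ p ∈ primeFactors r, p ≠ 0 := fun p hp =>
    (prime_of_normalized_factor p (mem_primeFactors.1 hp)).ne_zero
  have hg0 : ∏ p ∈ P, p ≠ 0 :=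
    Finset.prod_ne_zero_iff.2 fun p hp => hne p (Finset.mem_filter.1 hp).1
  have hh0 : ∏ p ∈ Q, p ≠ 0 :=
    Finset.prod_ne_zero_iff.2 fun p hp => hne p (Finset.mem_filter.1 hp).1
  have hdeg : r.natDegree ≤ (∏ p ∈ P, p).natDegree + u.natDegree := by
    have h1 : (∏ p ∈ Q, p) * ∏ p ∈ P, p = r := by
      conv_rhs => rw [← radical_eq_self hr hs]
      exact Finset.prod_filter_mul_prod_filter_not _ _ _
    have h2 : (∏ p ∈ Q, p).natDegree ≤ u.natDegree :=
      natDegree_le_of_dvd (primeFactors_prod_dvd (Finset.filter_subset _ _)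
        fun p hp => (Finset.mem_filter.1 hp).2) hu
    conv_lhs => rw [← h1, natDegree_mul hh0 hg0]
    omega
  let φ : F[X] → (p : P) → AdjoinRoot (p : F[X]) := fun x p => AdjoinRoot.mk (p : F[X]) x
  have himg : (S.image φ).card ≤ (d + 1) ^ (primeFactors r).card := by
    calc (S.image φ).card
        ≤ (Fintype.piFinset fun p : P => S.image (AdjoinRoot.mk (p : F[X]))).card := by
          refine Finset.card_le_card fun y hy => ?_
          obtain ⟨x, hx, rfl⟩ := Finset.mem_image.1 hy
          exact Fintype.mem_piFinset.2 fun p => Finset.mem_image_of_mem _ hx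
      _ ≤ ∏ _p : P, (d + 1) := by
          rw [Fintype.card_piFinset]
          refine Finset.prod_le_prod' fun p _ => ?_
          have hp := Finset.mem_filter.1 p.2
          refine (card_image_mk_le hd (prime_of_normalized_factor _ (mem_primeFactors.1 hp.1))
            hp.2 S fun x hx => ?_).trans (Nat.le_succ d)
          exact (dvd_of_mem_normalizedFactors (mem_primeFactors.1 hp.1)).trans
            (Finset.mem_filter.1 hx).2
      _ ≤ (d + 1) ^ (primeFactors r).card := by
          rw [Finset.prod_const, Finset.card_univ, Fintype.card_coe]
          exact Nat.pow_le_pow_right (by omega) (Finset.card_filter_le _ _)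
  have hfib := Finset.card_le_mul_card_image (f := φ) S
    (Fintype.card F ^ (M - (∏ p ∈ P, p).natDegree)) fun b _ => ?_
  · calc S.card ≤ _ := hfib
      _ ≤ Fintype.card F ^ (u.natDegree + (M - r.natDegree)) *
          (d + 1) ^ (primeFactors r).card := by
          refine Nat.mul_le_mul (Nat.pow_le_pow_right Fintype.card_pos ?_) himg
          omega
      _ = _ := mul_comm _ _
  · refine card_congr_le M hg0 _ ((Finset.filter_subset _ _).trans (Finset.filter_subset _ _)) ?_
    intro x hx y hy
    refine primeFactors_prod_dvd (Finset.filter_subset _ _) fun p hp => ?_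
    have hxy : φ x = φ y := (Finset.mem_filter.1 hx).2.trans (Finset.mem_filter.1 hy).2.symm
    rw [← AdjoinRoot.mk_eq_mk]
    exact congrFun hxy ⟨p, hp⟩

/-- The monic square-free polynomials of degree `Y`. -/
def moduli (F : Type*) [Field F] [Fintype F] (Y : ℕ) : Finset F[X] :=
  (box F (Y + 1)).filter fun r => r.Monic ∧ Squarefree r ∧ r.natDegree = Y

lemma mem_moduli {Y : ℕ} {r : F[X]} :
    r ∈ moduli F Y ↔ r.Monic ∧ Squarefree r ∧ r.natDegree = Y := by
  simp only [moduli, Finset.mem_filter, mem_box, and_iff_right_iff_imp]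
  rintro ⟨-, -, rfl⟩
  exact degree_le_natDegree.trans_lt (by exact_mod_cast Nat.lt_succ_self _)

lemma card_moduli_le (Y : ℕ) : (moduli F Y).card ≤ Fintype.card F ^ Y := by
  rw [← card_box]
  refine Finset.card_le_card_of_injOn (fun r => r - X ^ Y) (fun r hr => ?_)
    fun r _ s _ h => sub_left_injective h
  obtain ⟨h1, -, h2⟩ := mem_moduli.1 hr
  simp only [Finset.mem_coe, mem_box]
  have h3 : r.degree = Y := by rw [degree_eq_natDegree h1.ne_zero, h2]
  rw [← h3]
  refine degree_sub_lt_left ?_ h1.ne_zero ?_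
  · rw [h3, degree_X_pow]
  · rw [h1.leadingCoeff, (monic_X_pow Y).leadingCoeff]

/-- `K^{ω(f)} ≪ b^{deg f}` for every `b > 1`. -/
lemma exists_pow_card_primeFactors_le (F : Type*) [Field F] [Fintype F] {K b : ℝ} (hK : 1 ≤ K)
    (hb : 1 < b) : ∃ C : ℝ, 0 < C ∧ ∀ f : F[X], f ≠ 0 →
      K ^ (primeFactors f).card ≤ C * b ^ f.natDegree := by
  obtain ⟨L, hL⟩ := pow_unbounded_of_one_lt K hb
  refine ⟨K ^ (box F L).card, by positivity, fun f hf => ?_⟩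
  calc K ^ (primeFactors f).card
      = ∏ _p ∈ primeFactors f, K := by simp
    _ ≤ ∏ p ∈ primeFactors f, (if p ∈ box F L then K else 1) * b ^ p.natDegree := by
        refine Finset.prod_le_prod (fun _ _ => by positivity) fun p hp => ?_
        split_ifs with h
        · exact le_mul_of_one_le_right (by positivity) (one_le_pow₀ hb.le)
        · rw [one_mul]
          refine hL.le.trans (pow_le_pow_right₀ hb.le ?_)
          by_contra! hlt
          exact h (mem_box.2 (degree_le_natDegree.trans_lt (by exact_mod_cast hlt)))
    _ = K ^ ((primeFactors f).filter (· ∈ box F L)).card *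
          b ^ ∑ p ∈ primeFactors f, p.natDegree := by
        rw [Finset.prod_mul_distrib, Finset.prod_pow_eq_pow_sum, ← Finset.prod_filter,
          Finset.prod_const]
    _ ≤ _ := by
        refine mul_le_mul (pow_le_pow_right₀ hK (Finset.card_le_card fun p hp =>
          (Finset.mem_filter.1 hp).2)) (pow_le_pow_right₀ hb.le ?_) (by positivity) (by positivity)
        exact sum_natDegree_primeFactors_le hf

end OneVariable

section Elimination

/-- The linear change of variables `X₀ ↦ X₀`, `Xᵢ ↦ Xᵢ + aᵢ X₀`. -/
def shear {A : Type*} [CommRing A] {n : ℕ} (a : Fin n → A) :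
    MvPolynomial (Fin (n + 1)) A →ₐ[A] MvPolynomial (Fin (n + 1)) A :=
  MvPolynomial.aeval (Fin.cons (MvPolynomial.X 0)
    fun i => MvPolynomial.X i.succ + MvPolynomial.C (a i) * MvPolynomial.X 0)

section Shear

variable {A : Type*} [CommRing A] {n : ℕ}

@[simp] lemma shear_X_zero (a : Fin n → A) : shear a (MvPolynomial.X 0) = MvPolynomial.X 0 := by
  simp [shear]

@[simp] lemma shear_X_succ (a : Fin n → A) (i : Fin n) :
    shear a (MvPolynomial.X i.succ) =
      MvPolynomial.X i.succ + MvPolynomial.C (a i) * MvPolynomial.X 0 := by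
  simp [shear]

lemma shear_comp_shear_neg (a : Fin n → A) : (shear a).comp (shear (-a)) = AlgHom.id A _ := by
  refine MvPolynomial.algHom_ext fun i => ?_
  refine Fin.cases ?_ (fun i => ?_) i
  · simp
  · simp [MvPolynomial.algHom_C, MvPolynomial.algebraMap_eq]

lemma eval_shear (a : Fin n → A) (y : A) (x : Fin n → A) (H : MvPolynomial (Fin (n + 1)) A) :
    MvPolynomial.eval (Fin.cons y x) (shear a H) =
      MvPolynomial.eval (Fin.cons y fun i => x i + a i * y) H := by
  have : (MvPolynomial.aeval (Fin.cons y x : Fin (n + 1) → A)).comp (shear a) =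
      MvPolynomial.aeval (R := A) (Fin.cons y fun i => x i + a i * y : Fin (n + 1) → A) := by
    refine MvPolynomial.algHom_ext fun i => ?_
    refine Fin.cases ?_ (fun i => ?_) i <;> simp
  simpa [MvPolynomial.coe_aeval_eq_eval] using DFunLike.congr_fun this H

lemma map_shear {B : Type*} [CommRing B] (φ : A →+* B) (a : Fin n → A)
    (H : MvPolynomial (Fin (n + 1)) A) :
    MvPolynomial.map φ (shear a H) = shear (φ ∘ a) (MvPolynomial.map φ H) := by
  have : (MvPolynomial.map φ).comp (shear a).toRingHom =
      (shear (φ ∘ a)).toRingHom.comp (MvPolynomial.map φ) := by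
    refine MvPolynomial.ringHom_ext (fun c => ?_) fun i => ?_
    · simp [MvPolynomial.algHom_C, MvPolynomial.algebraMap_eq]
    · refine Fin.cases ?_ (fun i => ?_) i <;> simp
  exact DFunLike.congr_fun this H

lemma IsRelPrime.shear {a : Fin n → A} {G H : MvPolynomial (Fin (n + 1)) A}
    (h : IsRelPrime G H) : IsRelPrime (shear a G) (shear a H) := by
  have h1 (P : MvPolynomial (Fin (n + 1)) A) :
      EkedahlSieve.shear a (EkedahlSieve.shear (-a) P) = P :=
    DFunLike.congr_fun (shear_comp_shear_neg a) P
  have h2 (P : MvPolynomial (Fin (n + 1)) A) :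
      EkedahlSieve.shear (-a) (EkedahlSieve.shear a P) = P := by
    simpa using DFunLike.congr_fun (shear_comp_shear_neg (-a)) P
  intro d hG hH
  have := h (map_dvd (EkedahlSieve.shear (-a)) hG |>.trans (h2 G).dvd)
    (map_dvd (EkedahlSieve.shear (-a)) hH |>.trans (h2 H).dvd)
  rw [← h1 d]
  exact this.map _

lemma finSuccEquiv_shear_monomial (a : Fin n → A) (m : Fin (n + 1) →₀ ℕ) :
    (MvPolynomial.finSuccEquiv A n (shear a (MvPolynomial.monomial m 1))).natDegree ≤ m.degree ∧
    (MvPolynomial.finSuccEquiv A n (shear a (MvPolynomial.monomial m 1))).coeff m.degree =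
      MvPolynomial.C (MvPolynomial.eval (Fin.cons 1 a) (MvPolynomial.monomial m 1)) := by
  induction m using Finsupp.induction_linear with
  | zero => simp
  | add m m' h h' =>
    have e : (MvPolynomial.monomial (m + m') (1 : A)) =
        MvPolynomial.monomial m 1 * MvPolynomial.monomial m' 1 := by
      simp [MvPolynomial.monomial_mul]
    rw [e]
    simp only [map_mul]
    refine ⟨?_, ?_⟩
    · exact natDegree_mul_le.trans ((add_le_add h.1 h'.1).trans (by simp))
    · rw [← h.2, ← h'.2, map_add]
      exact coeff_mul_add_eq_of_natDegree_le h.1 h'.1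
  | single i k =>
    rw [← MvPolynomial.X_pow_eq_monomial]
    simp only [map_pow, Finsupp.degree_single]
    have : (MvPolynomial.finSuccEquiv A n (shear a (MvPolynomial.X i))).natDegree ≤ 1 ∧
        (MvPolynomial.finSuccEquiv A n (shear a (MvPolynomial.X i))).coeff 1 =
          MvPolynomial.C (MvPolynomial.eval (Fin.cons 1 a) (MvPolynomial.X i)) := by
      refine Fin.cases ?_ (fun i => ?_) i
      · simp [MvPolynomial.finSuccEquiv_X_zero, natDegree_X_le]
      · have e : MvPolynomial.finSuccEquiv A n (MvPolynomial.C (a i)) =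
            C (MvPolynomial.C (a i)) := by
          simp [MvPolynomial.finSuccEquiv_apply]
        simp only [shear_X_succ, map_add, map_mul, MvPolynomial.finSuccEquiv_X_zero,
          MvPolynomial.finSuccEquiv_X_succ, e]
        refine ⟨?_, by simp⟩
        rw [add_comm]
        exact natDegree_linear_le
    refine ⟨?_, ?_⟩
    · simpa using natDegree_pow_le_of_le k this.1
    · simpa [this.2] using coeff_pow_of_natDegree_le (m := k) this.1

/-- After a shear, the coefficient of `X₀^{deg H}` is the value of the leading form of `H` at the
direction of the shear. -/
lemma finSuccEquiv_shear (a : Fin n → A) (H : MvPolynomial (Fin (n + 1)) A) :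
    (MvPolynomial.finSuccEquiv A n (shear a H)).natDegree ≤ H.totalDegree ∧
    (MvPolynomial.finSuccEquiv A n (shear a H)).coeff H.totalDegree =
      MvPolynomial.C (MvPolynomial.eval (Fin.cons 1 a)
        (MvPolynomial.homogeneousComponent H.totalDegree H)) := by
  have e : MvPolynomial.finSuccEquiv A n (shear a H) =
      ∑ m ∈ H.support, C (MvPolynomial.C (H.coeff m)) *
      MvPolynomial.finSuccEquiv A n (shear a (MvPolynomial.monomial m 1)) := by
    conv_lhs => rw [H.as_sum]
    simp only [map_sum]
    refine Finset.sum_congr rfl fun m _ => ?_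
    rw [← mul_one (H.coeff m), ← MvPolynomial.C_mul_monomial, mul_one]
    simp only [map_mul, MvPolynomial.algHom_C, MvPolynomial.algebraMap_eq]
    congr 1
    simp [MvPolynomial.finSuccEquiv_apply]
  have hle : ∀ m ∈ H.support, m.degree ≤ H.totalDegree := fun m hm => MvPolynomial.le_totalDegree hm
  rw [e]
  refine ⟨natDegree_sum_le_of_forall_le _ _ fun m hm => ?_, ?_⟩
  · exact (natDegree_C_mul_le _ _).trans ((finSuccEquiv_shear_monomial a m).1.trans (hle m hm))
  · rw [MvPolynomial.homogeneousComponent_apply, finsetSum_coeff, Finset.sum_filter,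
      map_sum, map_sum]
    refine Finset.sum_congr rfl fun m hm => ?_
    rw [coeff_C_mul]
    split_ifs with h
    · rw [← h, (finSuccEquiv_shear_monomial a m).2, ← map_mul, MvPolynomial.eval_monomial,
        MvPolynomial.eval_monomial, one_mul]
    · rw [coeff_eq_zero_of_natDegree_lt, mul_zero, map_zero, map_zero]
      exact (finSuccEquiv_shear_monomial a m).1.trans_lt ((hle m hm).lt_of_ne h)

lemma exists_eval_cons_one_ne_zero [IsDomain A] [Infinite A] {d : ℕ}
    {G : MvPolynomial (Fin (n + 1)) A} (hG : G.IsHomogeneous d) (h0 : G ≠ 0) :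
    ∃ a : Fin n → A, MvPolynomial.eval (Fin.cons 1 a) G ≠ 0 := by
  set f := MvPolynomial.finSuccEquiv A n G
  have hf0 : f ≠ 0 := by simpa [f] using h0
  by_contra! h
  have hP : f.eval 1 = 0 := by
    refine MvPolynomial.funext fun a => ?_
    have := h a
    rw [MvPolynomial.eval_eq_eval_mv_eval', eval_map, ← map_one (MvPolynomial.eval a),
      eval₂_at_apply] at this
    simpa using this
  have hdeg : f.natDegree < d + 1 := by
    have h1 : f.natDegree = _ := MvPolynomial.natDegree_finSuccEquiv G
    have := MvPolynomial.degreeOf_le_totalDegree G 0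
    have := hG.totalDegree_le
    omega
  rw [eval_eq_sum_range' hdeg] at hP
  simp only [one_pow, mul_one] at hP
  obtain ⟨i, hi⟩ : ∃ i, f.coeff i ≠ 0 := by
    by_contra! h
    exact hf0 (Polynomial.ext h)
  have hid : i ≤ d := by
    by_contra! hlt
    exact hi (coeff_eq_zero_of_natDegree_lt (by omega))
  apply hi
  have := congrArg (MvPolynomial.homogeneousComponent (d - i)) hP
  rw [map_sum, Finset.sum_eq_single i, map_zero,
    MvPolynomial.homogeneousComponent_of_mem
      (hG.finSuccEquiv_coeff_isHomogeneous i (d - i) (by omega)), if_pos rfl] at this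
  · exact this
  · intro j hj hji
    rw [Finset.mem_range] at hj
    rw [MvPolynomial.homogeneousComponent_of_mem
      (hG.finSuccEquiv_coeff_isHomogeneous j (d - j) (by omega)), if_neg (by omega)]
  · intro h
    exact absurd (Finset.mem_range.2 (by omega)) h

/-- A linear change of variables makes the leading coefficient in `X₀` constant. -/
lemma exists_shear [IsDomain A] [Infinite A] {H : MvPolynomial (Fin (n + 1)) A} (hH : H ≠ 0) :
    ∃ (a : Fin n → A) (d : ℕ) (u : A), u ≠ 0 ∧
      (MvPolynomial.finSuccEquiv A n (shear a H)).natDegree ≤ d ∧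
      (MvPolynomial.finSuccEquiv A n (shear a H)).coeff d = MvPolynomial.C u := by
  obtain ⟨a, ha⟩ := exists_eval_cons_one_ne_zero
    (MvPolynomial.homogeneousComponent_isHomogeneous H.totalDegree H) (by
      obtain ⟨m, hm, hm'⟩ := Finset.exists_mem_eq_sup _ (MvPolynomial.support_nonempty.2 hH)
        (fun s : Fin (n + 1) →₀ ℕ => s.sum fun _ e => e)
      intro h0
      have := congrArg (MvPolynomial.coeff m) h0
      rw [MvPolynomial.coeff_homogeneousComponent, if_pos] at this
      · exact MvPolynomial.mem_support_iff.1 hm (by simpa using this)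
      · exact hm'.symm)
  exact ⟨a, _, _, ha, finSuccEquiv_shear a H⟩

end Shear

/-- A monic polynomial and a polynomial coprime to it over a factorial domain have a nonzero
constant in the ideal they generate. -/
lemma exists_combination_eq_C {A : Type*} [CommRing A] [IsDomain A] [UniqueFactorizationMonoid A]
    {f g : A[X]} (hf : f.Monic) (h : IsRelPrime f g) :
    ∃ R : A, R ≠ 0 ∧ ∃ a b : A[X], a * f + b * g = C R := by
  have := hf.finite_adjoinRoot
  obtain ⟨p, hp, hp0⟩ := Algebra.IsIntegral.isIntegral (R := A) (AdjoinRoot.mk f g)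
  obtain ⟨i, hi, hi'⟩ := Ideal.exists_coeff_ne_zero_mem_comap_of_non_zero_divisor_root_mem
    (f := algebraMap A (AdjoinRoot f)) (I := Ideal.span {AdjoinRoot.mk f g}) (fun {x} hx => by
      obtain ⟨x, rfl⟩ := AdjoinRoot.mk_surjective x
      rw [← map_mul, AdjoinRoot.mk_eq_zero] at hx
      exact AdjoinRoot.mk_eq_zero.2 (h.dvd_of_dvd_mul_right hx))
    (Ideal.mem_span_singleton_self _) hp.ne_zero hp0
  refine ⟨p.coeff i, hi, ?_⟩
  rw [Ideal.mem_comap, Ideal.mem_span_singleton] at hi'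
  obtain ⟨y, hy⟩ := hi'
  obtain ⟨b, rfl⟩ := AdjoinRoot.mk_surjective y
  have : AdjoinRoot.mk f (C (p.coeff i)) = AdjoinRoot.mk f (g * b) := by
    rw [map_mul, ← hy]
    rfl
  rw [AdjoinRoot.mk_eq_mk] at this
  obtain ⟨a, ha⟩ := this
  exact ⟨a, b, by linear_combination -ha⟩

lemma exists_clear_denominators {A K σ : Type*} [CommRing A] [IsDomain A] [Field K] [Algebra A K]
    [IsFractionRing A K] (p : MvPolynomial σ K) : ∃ s : A, s ≠ 0 ∧ ∃ P : MvPolynomial σ A,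
      MvPolynomial.map (algebraMap A K) P = MvPolynomial.C (algebraMap A K s) * p := by
  obtain ⟨s, hs⟩ := IsLocalization.exist_integer_multiples (nonZeroDivisors A) p.support p.coeff
  choose! c hc using hs
  refine ⟨s, nonZeroDivisors.coe_ne_zero s, ∑ m ∈ p.support, MvPolynomial.monomial m (c m), ?_⟩
  conv_rhs => rw [p.as_sum]
  rw [map_sum, Finset.mul_sum]
  refine Finset.sum_congr rfl fun m hm => ?_
  rw [MvPolynomial.map_monomial, hc m hm, MvPolynomial.C_mul_monomial, Algebra.smul_def]

lemma finSuccEquiv_map {A B : Type*} [CommRing A] [CommRing B] {n : ℕ} (φ : A →+* B)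
    (H : MvPolynomial (Fin (n + 1)) A) :
    MvPolynomial.finSuccEquiv B n (MvPolynomial.map φ H) =
      (MvPolynomial.finSuccEquiv A n H).map (MvPolynomial.map φ) := by
  ext i m
  rw [MvPolynomial.finSuccEquiv_coeff_coeff, coeff_map, MvPolynomial.coeff_map,
    MvPolynomial.coeff_map, MvPolynomial.finSuccEquiv_coeff_coeff]

/-- Elimination of `X₀` from two polynomials that are coprime over the field of fractions, one of
which has constant leading coefficient in `X₀`. -/
lemma exists_elimination {A : Type*} (K : Type*) [CommRing A] [IsDomain A] [Field K] [Algebra A K]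
    [IsFractionRing A K] {n : ℕ} {G H : MvPolynomial (Fin (n + 1)) A} {d : ℕ} {u : A} (hu : u ≠ 0)
    (hd : (MvPolynomial.finSuccEquiv A n G).natDegree ≤ d)
    (hc : (MvPolynomial.finSuccEquiv A n G).coeff d = MvPolynomial.C u)
    (hcop : IsRelPrime (MvPolynomial.map (algebraMap A K) G)
      (MvPolynomial.map (algebraMap A K) H)) :
    ∃ R : MvPolynomial (Fin n) A, R ≠ 0 ∧ ∃ a b : MvPolynomial (Fin (n + 1)) A,
      a * G + b * H = MvPolynomial.rename Fin.succ R := by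
  set ι := algebraMap A K
  have hι : Function.Injective ι := IsFractionRing.injective A K
  have hu' : ι u ≠ 0 := (map_ne_zero_iff ι hι).2 hu
  set E := MvPolynomial.finSuccEquiv K n
  set v : MvPolynomial (Fin n) K := MvPolynomial.C (ι u)⁻¹
  have hv : IsUnit (C v) := ((isUnit_iff_ne_zero.2 (inv_ne_zero hu')).map MvPolynomial.C).map C
  have hmonic : (C v * E (MvPolynomial.map ι G)).Monic := by
    refine monic_of_natDegree_le_of_coeff_eq_one d ?_ ?_
    · refine (natDegree_C_mul_le _ _).trans ?_
      rw [finSuccEquiv_map]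
      exact natDegree_map_le.trans hd
    · rw [coeff_C_mul, finSuccEquiv_map, coeff_map, hc, MvPolynomial.map_C, ← map_mul,
        inv_mul_cancel₀ hu', map_one]
  have hrel : IsRelPrime (C v * E (MvPolynomial.map ι G)) (E (MvPolynomial.map ι H)) := by
    rw [isRelPrime_mul_unit_left_left hv]
    intro x hx hy
    have h1 := map_dvd E.symm hx
    have h2 := map_dvd E.symm hy
    rw [AlgEquiv.symm_apply_apply] at h1 h2
    simpa using (hcop h1 h2).map E
  obtain ⟨R, hR, a, b, hab⟩ := exists_combination_eq_C hmonic hrel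
  have hE : E (MvPolynomial.rename Fin.succ R) = C R := by
    have : (E : MvPolynomial (Fin (n + 1)) K →ₐ[K] _).comp (MvPolynomial.rename Fin.succ) =
        Algebra.algHom K (MvPolynomial (Fin n) K) (MvPolynomial (Fin n) K)[X] :=
      MvPolynomial.algHom_ext fun i => by
        simp only [E, AlgHom.comp_apply, MvPolynomial.rename_X]
        exact MvPolynomial.finSuccEquiv_X_succ
    exact DFunLike.congr_fun this R
  have hab' : E.symm (a * C v) * MvPolynomial.map ι G + E.symm b * MvPolynomial.map ι H =
      MvPolynomial.rename Fin.succ R := by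
    apply E.injective
    simp only [map_add, map_mul, AlgEquiv.apply_symm_apply]
    rw [hE, ← hab]
    ring
  obtain ⟨s, hs, P, hP : MvPolynomial.map ι P = MvPolynomial.C (ι s) * _⟩ :=
    exists_clear_denominators (A := A) (E.symm (a * C v))
  obtain ⟨t, ht, Q, hQ : MvPolynomial.map ι Q = MvPolynomial.C (ι t) * _⟩ :=
    exists_clear_denominators (A := A) (E.symm b)
  obtain ⟨w, hw, S, hS : MvPolynomial.map ι S = MvPolynomial.C (ι w) * _⟩ :=
    exists_clear_denominators (A := A) R
  refine ⟨MvPolynomial.C (s * t) * S, ?_, MvPolynomial.C (t * w) * P, MvPolynomial.C (s * w) * Q,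
    ?_⟩
  · refine mul_ne_zero (by simpa using ⟨hs, ht⟩) fun h => ?_
    rw [h, map_zero] at hS
    have : ι w ≠ 0 := (map_ne_zero_iff ι hι).2 hw
    exact mul_ne_zero ((map_ne_zero_iff _ (MvPolynomial.C_injective _ _)).2 this) hR hS.symm
  · apply MvPolynomial.map_injective ι hι
    have hS' := congrArg (MvPolynomial.rename (Fin.succ : Fin n → Fin (n + 1))) hS
    rw [map_mul, MvPolynomial.rename_C] at hS'
    simp only [map_add, map_mul, MvPolynomial.map_rename, MvPolynomial.map_C,
      MvPolynomial.rename_C, hP, hQ, hS', ← hab']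
    ring

end Elimination

section SeveralVariables

variable {F : Type*} [Field F] {n : ℕ}

lemma eval_cons_eq (H : MvPolynomial (Fin (n + 1)) F[X]) (a : Fin n → F[X]) (y : F[X])
    (x : Fin n → F[X]) :
    MvPolynomial.eval (Fin.cons y fun i => x i + a i * y) H =
      ((MvPolynomial.finSuccEquiv F[X] n (shear a H)).map (MvPolynomial.eval x)).eval y := by
  rw [← eval_shear, MvPolynomial.eval_eq_eval_mv_eval']

variable [Fintype F]

/-- The points all of whose coordinates have degree less than `M`. -/
def boxes (F : Type*) [Field F] [Fintype F] (n M : ℕ) : Finset (Fin n → F[X]) :=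
  Fintype.piFinset fun _ => box F M

lemma mem_boxes {M : ℕ} {c : Fin n → F[X]} : c ∈ boxes F n M ↔ ∀ i, (c i).degree < M := by
  simp [boxes, mem_box]

lemma card_boxes (M : ℕ) : (boxes F n M).card = Fintype.card F ^ (n * M) := by
  simp [boxes, card_box, ← pow_mul, mul_comm]

lemma card_filter_boxes_le_sum (M : ℕ) (P : (Fin (n + 1) → F[X]) → Prop) :
    ((boxes F (n + 1) M).filter P).card ≤
      ∑ x ∈ boxes F n M, ((box F M).filter fun y => P (Fin.cons y x)).card := by
  rw [Finset.card_eq_sum_card_fiberwise (f := Fin.tail) (t := boxes F n M)]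
  · refine Finset.sum_le_sum fun x _ => ?_
    refine Finset.card_le_card_of_injOn (fun c => c 0) (fun c hc => ?_) fun c hc c' hc' h => ?_
    · simp only [Finset.coe_filter, Finset.mem_filter, Set.mem_ofPred_eq] at hc ⊢
      obtain ⟨⟨h1, h2⟩, rfl⟩ := hc
      exact ⟨mem_box.2 (mem_boxes.1 h1 0), by rwa [Fin.cons_self_tail]⟩
    · simp only [Finset.coe_filter, Finset.mem_filter, Set.mem_ofPred_eq] at hc hc'
      rw [← Fin.cons_self_tail c, ← Fin.cons_self_tail c', hc.2, hc'.2]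
      simp only at h
      rw [h]
  · intro c hc
    simp only [Finset.coe_filter, Set.mem_ofPred_eq] at hc
    exact mem_boxes.2 fun i => mem_boxes.1 hc.1 i.succ

/-- A shear maps a box into a box with sides longer by a constant factor. -/
lemma exists_card_filter_boxes_le (a : Fin n → F[X]) : ∃ s : ℕ, ∀ (M : ℕ)
    (P : (Fin (n + 1) → F[X]) → Prop), ((boxes F (n + 1) M).filter P).card ≤
      ((boxes F (n + 1) (M + s)).filter fun x =>
        P (Fin.cons (x 0) fun i => x i.succ + a i * x 0)).card := by
  refine ⟨∑ i, (a i).natDegree, fun M P => ?_⟩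
  refine Finset.card_le_card_of_injOn (fun c => Fin.cons (c 0) fun i => c i.succ - a i * c 0)
    (fun c hc => ?_) fun c _ c' _ h => ?_
  · simp only [Finset.coe_filter, Set.mem_ofPred_eq, mem_boxes] at hc ⊢
    have hM : (M : WithBot ℕ) ≤ ((M + ∑ i, (a i).natDegree : ℕ) : WithBot ℕ) := by
      exact_mod_cast Nat.le_add_right _ _
    have key : ∀ i, ((Fin.cons (c 0) (fun i => c i.succ - a i * c 0) :
        Fin (n + 1) → F[X]) i).degree < ((M + ∑ i, (a i).natDegree : ℕ) : WithBot ℕ) := by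
      refine fun i => Fin.cases ?_ (fun i => ?_) i
      · simpa using (hc.1 0).trans_le hM
      · simp only [Fin.cons_succ]
        refine (degree_sub_le _ _).trans_lt (max_lt ((hc.1 i.succ).trans_le hM) ?_)
        by_cases h0 : c 0 = 0
        · rw [h0, mul_zero, degree_zero]
          exact WithBot.bot_lt_coe _
        · refine (degree_mul_le _ _).trans_lt ?_
          have h1 := hc.1 0
          have h2 : (a i).natDegree ≤ ∑ i, (a i).natDegree :=
            Finset.single_le_sum (f := fun i => (a i).natDegree) (fun _ _ => Nat.zero_le _)
              (Finset.mem_univ i)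
          rw [degree_eq_natDegree h0] at h1 ⊢
          refine (add_le_add_left degree_le_natDegree _).trans_lt ?_
          have h1' : (c 0).natDegree < M := by exact_mod_cast h1
          exact_mod_cast (by omega : (a i).natDegree + (c 0).natDegree < M + ∑ i, (a i).natDegree)
    refine ⟨key, ?_⟩
    convert hc.2 using 1
    exact _root_.funext fun i => Fin.cases (by simp) (fun i => by simp) i
  · have h0 : c 0 = c' 0 := by simpa using congrFun h 0
    refine _root_.funext fun i => Fin.cases h0 (fun i => ?_) i
    have := congrFun h i.succ
    simpa [h0] using this

lemma card_dvd_fiber_le {G : MvPolynomial (Fin (n + 1)) F[X]} {d : ℕ} {u : F[X]} (hu : u ≠ 0)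
    (hd : (MvPolynomial.finSuccEquiv F[X] n G).natDegree ≤ d)
    (hc : (MvPolynomial.finSuccEquiv F[X] n G).coeff d = MvPolynomial.C u) {Y : ℕ} {r : F[X]}
    (hr : r ∈ moduli F Y) (M : ℕ) (x : Fin n → F[X]) :
    ((box F M).filter fun y => r ∣ ((MvPolynomial.finSuccEquiv F[X] n G).map
      (MvPolynomial.eval x)).eval y).card ≤
      (d + 1) ^ (primeFactors r).card * Fintype.card F ^ (u.natDegree + (M - Y)) := by
  obtain ⟨h1, h2, rfl⟩ := mem_moduli.1 hr
  have hc' : ((MvPolynomial.finSuccEquiv F[X] n G).map (MvPolynomial.eval x)).coeff d = u := by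
    rw [coeff_map, hc, MvPolynomial.eval_C]
  have := card_dvd_eval_le (natDegree_map_le.trans hd) (hc'.trans_ne hu) h1 h2 M
  rwa [hc'] at this

/-- The number of points of a box at which a nonzero polynomial is divisible by a square-free
modulus that is not larger than the side of the box. -/
lemma exists_card_dvd_eval_mvPolynomial_le {R : MvPolynomial (Fin n) F[X]} (hR : R ≠ 0) :
    ∃ A K : ℕ, 1 ≤ K ∧ ∀ (M Y : ℕ) (r : F[X]), r ∈ moduli F Y → Y ≤ M →
      ((boxes F n M).filter fun c => r ∣ MvPolynomial.eval c R).card * Fintype.card F ^ Y ≤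
        A * K ^ (primeFactors r).card * Fintype.card F ^ (n * M) := by
  obtain _ | n := n
  · refine ⟨Fintype.card F ^ (MvPolynomial.eval 0 R).natDegree, 1, le_rfl, fun M Y r hr _ => ?_⟩
    obtain ⟨-, -, rfl⟩ := mem_moduli.1 hr
    obtain h | ⟨c, hc⟩ :=
      ((boxes F 0 M).filter fun c => r ∣ MvPolynomial.eval c R).eq_empty_or_nonempty
    · simp [h]
    · have hdvd := (Finset.mem_filter.1 hc).2
      rw [Subsingleton.elim c 0] at hdvd
      have h0 : MvPolynomial.eval 0 R ≠ 0 := by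
        intro h0
        refine hR (MvPolynomial.funext fun c => ?_)
        rw [Subsingleton.elim c 0, h0, map_zero]
      simp only [one_pow, mul_one, zero_mul, pow_zero]
      calc _ ≤ 1 * Fintype.card F ^ r.natDegree :=
            Nat.mul_le_mul_right _ (Finset.card_le_one_of_subsingleton _)
        _ ≤ _ := by
            rw [one_mul]
            exact Nat.pow_le_pow_right Fintype.card_pos (natDegree_le_of_dvd hdvd h0)
  · obtain ⟨a, d, u, hu, hd, hc⟩ := exists_shear hR
    obtain ⟨s, hs⟩ := exists_card_filter_boxes_le a
    refine ⟨Fintype.card F ^ ((n + 1) * s + u.natDegree), d + 1, by omega,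
      fun M Y r hr hY => ?_⟩
    have h1 := (hs M fun c => r ∣ MvPolynomial.eval c R).trans (card_filter_boxes_le_sum _ _)
    simp only [Fin.cons_zero, Fin.cons_succ, eval_cons_eq] at h1
    have h2 := h1.trans (Finset.sum_le_sum fun x _ => card_dvd_fiber_le hu hd hc hr (M + s) x)
    rw [Finset.sum_const, card_boxes, smul_eq_mul] at h2
    refine (Nat.mul_le_mul_right _ h2).trans (le_of_eq ?_)
    obtain ⟨k, rfl⟩ := Nat.exists_eq_add_of_le hY
    rw [show Y + k + s - Y = k + s by omega]
    ring

lemma card_eval_eq_zero_mul_le {R : MvPolynomial (Fin n) F[X]} (hR : R ≠ 0) (M : ℕ) :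
    ((boxes F n M).filter fun c => MvPolynomial.eval c R = 0).card * Fintype.card F ^ M ≤
      R.totalDegree * Fintype.card F ^ (n * M) := by
  have h := MvPolynomial.schwartz_zippel_totalDegree hR (box F M)
  have hq : (0 : ℚ≥0) < Fintype.card F := by exact_mod_cast Fintype.card_pos
  rw [card_box, div_le_div_iff₀ (by push_cast; positivity) (by push_cast; positivity)] at h
  have h' : ((Fintype.piFinset fun _ => box F M).filter fun c : Fin n → F[X] =>
      MvPolynomial.eval c R = 0).card * Fintype.card F ^ M ≤
      R.totalDegree * (Fintype.card F ^ M) ^ n := by exact_mod_cast h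
  rwa [← pow_mul, mul_comm M] at h'

lemma exists_natDegree_eval_le (R : MvPolynomial (Fin n) F[X]) :
    ∃ B : ℕ, ∀ M, ∀ c ∈ boxes F n M, (MvPolynomial.eval c R).natDegree ≤ B * (M + 1) := by
  induction R using MvPolynomial.induction_on with
  | C a => exact ⟨a.natDegree, fun M c _ => by simpa using Nat.le_mul_of_pos_right _ M.succ_pos⟩
  | add p q hp hq =>
    obtain ⟨A, hA⟩ := hp
    obtain ⟨B, hB⟩ := hq
    refine ⟨A + B, fun M c hc => ?_⟩
    rw [map_add]
    refine (natDegree_add_le _ _).trans (max_le ?_ ?_)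
    · exact (hA M c hc).trans (Nat.mul_le_mul_right _ (Nat.le_add_right _ _))
    · exact (hB M c hc).trans (Nat.mul_le_mul_right _ (Nat.le_add_left _ _))
  | mul_X p i hp =>
    obtain ⟨A, hA⟩ := hp
    refine ⟨A + 1, fun M c hc => ?_⟩
    rw [map_mul, MvPolynomial.eval_X]
    refine natDegree_mul_le.trans ?_
    have h1 := hA M c hc
    have h2 : (c i).natDegree ≤ M := natDegree_le_of_degree_le (mem_boxes.1 hc i).le
    rw [add_mul]
    omega

end SeveralVariables

section CommonDivisors

variable {F : Type*} [Field F] [Fintype F] {n : ℕ}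

/-- Elimination bounds the number of points at which two coprime polynomials have a common
square-free divisor of given degree by a sum over the values of one polynomial in fewer
variables. -/
lemma exists_card_common_dvd_le_sum {H₀ H₁ : MvPolynomial (Fin (n + 1)) F[X]} (hH₀ : H₀ ≠ 0)
    (hcop : IsRelPrime (MvPolynomial.map (algebraMap F[X] (RatFunc F)) H₀)
      (MvPolynomial.map (algebraMap F[X] (RatFunc F)) H₁)) :
    ∃ (d e s : ℕ) (R : MvPolynomial (Fin n) F[X]), R ≠ 0 ∧ ∀ M Y : ℕ,
      ((boxes F (n + 1) M).filter fun c => ∃ r ∈ moduli F Y,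
        r ∣ MvPolynomial.eval c H₀ ∧ r ∣ MvPolynomial.eval c H₁).card ≤
      ∑ x ∈ boxes F n (M + s), min (Fintype.card F ^ (M + s))
        (∑ r ∈ (moduli F Y).filter fun r => r ∣ MvPolynomial.eval x R,
          (d + 1) ^ (primeFactors r).card * Fintype.card F ^ (e + (M + s - Y))) := by
  obtain ⟨a, d, u, hu, hd, hc⟩ := exists_shear hH₀
  have hcop' := IsRelPrime.shear (a := algebraMap F[X] (RatFunc F) ∘ a) hcop
  rw [← map_shear, ← map_shear] at hcop'
  obtain ⟨R, hR, p, q, hpq⟩ := exists_elimination (RatFunc F) hu hd hc hcop'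
  obtain ⟨s, hs⟩ := exists_card_filter_boxes_le a
  refine ⟨d, u.natDegree, s, R, hR, fun M Y => ?_⟩
  have hfib : ∀ x : Fin n → F[X], ∀ y ∈ box F (M + s), ∀ r ∈ moduli F Y,
      r ∣ MvPolynomial.eval (Fin.cons y fun i => x i + a i * y) H₀ →
      r ∣ MvPolynomial.eval (Fin.cons y fun i => x i + a i * y) H₁ →
      r ∣ MvPolynomial.eval x R := by
    intro x y _ r _ h₀ h₁
    have h := congrArg (MvPolynomial.eval (Fin.cons y x)) hpq
    rw [MvPolynomial.eval_rename, map_add, map_mul, map_mul, eval_shear, eval_shear] at h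
    have hx : (Fin.cons y x : Fin (n + 1) → F[X]) ∘ Fin.succ = x :=
      _root_.funext fun i => Fin.cons_succ (α := fun _ => F[X]) y x i
    rw [hx] at h
    rw [← h]
    exact dvd_add (Dvd.dvd.mul_left h₀ _) (Dvd.dvd.mul_left h₁ _)
  clear hpq hcop hcop'
  have h := (hs M fun c => ∃ r ∈ moduli F Y, r ∣ MvPolynomial.eval c H₀ ∧
    r ∣ MvPolynomial.eval c H₁).trans (card_filter_boxes_le_sum _ _)
  simp only [Fin.cons_zero, Fin.cons_succ] at h
  refine (Eq.le ?_).trans (h.trans (Finset.sum_le_sum fun x _ => le_min ?_ ?_))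
  · congr
  · rw [← card_box]
    exact Finset.card_filter_le _ _
  · set S := (moduli F Y).filter fun r => r ∣ MvPolynomial.eval x R with hS
    refine (Finset.card_le_card (t := S.biUnion
      fun r => (box F (M + s)).filter fun y => r ∣ ((MvPolynomial.finSuccEquiv F[X] n
        (shear a H₀)).map (MvPolynomial.eval x)).eval y) fun y hy => ?_).trans
      (Finset.card_biUnion_le.trans (Finset.sum_le_sum fun r hr =>
        card_dvd_fiber_le hu hd hc (Finset.mem_filter.1 hr).1 _ x))
    obtain ⟨hy, r, hr, h₀, h₁⟩ := Finset.mem_filter.1 hy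
    refine Finset.mem_biUnion.2 ⟨r, Finset.mem_filter.2 ⟨hr, hfib x y hy r hr h₀ h₁⟩,
      Finset.mem_filter.2 ⟨hy, by rwa [← eval_cons_eq]⟩⟩

/-- The contribution of the moduli that are not larger than the side of the box. -/
lemma exists_sum_dvd_eval_le {R : MvPolynomial (Fin n) F[X]} (hR : R ≠ 0) (d e : ℕ) {b : ℝ}
    (hb : 1 < b) : ∃ C : ℝ, 0 < C ∧ ∀ M Y : ℕ, Y ≤ M →
      ((∑ x ∈ boxes F n M, ∑ r ∈ (moduli F Y).filter fun r => r ∣ MvPolynomial.eval x R,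
        (d + 1) ^ (primeFactors r).card * Fintype.card F ^ (e + (M - Y)) : ℕ) : ℝ) ≤
      C * b ^ Y * ((Fintype.card F : ℝ) ^ ((n + 1) * M) / (Fintype.card F : ℝ) ^ Y) := by
  obtain ⟨A, K, hK, h⟩ := exists_card_dvd_eval_mvPolynomial_le hR
  obtain ⟨C, hC, hC'⟩ := exists_pow_card_primeFactors_le F (K := K * (d + 1)) (b := b)
    (by exact_mod_cast Nat.mul_pos hK d.succ_pos) hb
  have hq : (0 : ℝ) < Fintype.card F := by exact_mod_cast Fintype.card_pos
  refine ⟨(A + 1) * C * (Fintype.card F : ℝ) ^ e, by positivity, fun M Y hY => ?_⟩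
  have hswap : (∑ x ∈ boxes F n M, ∑ r ∈ (moduli F Y).filter fun r => r ∣ MvPolynomial.eval x R,
        (d + 1) ^ (primeFactors r).card * Fintype.card F ^ (e + (M - Y))) =
      ∑ r ∈ moduli F Y, ((boxes F n M).filter fun x => r ∣ MvPolynomial.eval x R).card *
        ((d + 1) ^ (primeFactors r).card * Fintype.card F ^ (e + (M - Y))) := by
    simp only [Finset.sum_filter]
    rw [Finset.sum_comm]
    refine Finset.sum_congr rfl fun r _ => ?_
    rw [← Finset.sum_filter, Finset.sum_const, smul_eq_mul]
  rw [hswap, Nat.cast_sum]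
  have hterm : ∀ r ∈ moduli F Y,
      ((((boxes F n M).filter fun x => r ∣ MvPolynomial.eval x R).card *
        ((d + 1) ^ (primeFactors r).card * Fintype.card F ^ (e + (M - Y))) : ℕ) : ℝ) ≤
      (A + 1) * C * (Fintype.card F : ℝ) ^ e * b ^ Y *
        ((Fintype.card F : ℝ) ^ ((n + 1) * M) / (Fintype.card F : ℝ) ^ (2 * Y)) := by
    intro r hr
    have h1 : ((((boxes F n M).filter fun x => r ∣ MvPolynomial.eval x R).card *
        Fintype.card F ^ Y : ℕ) : ℝ) ≤ _ := Nat.cast_le.2 (h M Y r hr hY)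
    have h2 := hC' r (mem_moduli.1 hr).1.ne_zero
    rw [(mem_moduli.1 hr).2.2] at h2
    push_cast at h1 ⊢
    rw [mul_div_assoc', le_div_iff₀ (by positivity)]
    obtain ⟨k, rfl⟩ := Nat.exists_eq_add_of_le hY
    rw [Nat.add_sub_cancel_left]
    set N : ℝ := (((boxes F n (Y + k)).filter fun x => r ∣ MvPolynomial.eval x R).card : ℝ)
    set q : ℝ := (Fintype.card F : ℝ)
    set w := (primeFactors r).card
    calc N * ((d + 1) ^ w * q ^ (e + k)) * q ^ (2 * Y)
        = (N * q ^ Y) * ((d + 1) ^ w * q ^ (e + k + Y)) := by ring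
      _ ≤ (A * K ^ w * q ^ (n * (Y + k))) * ((d + 1) ^ w * q ^ (e + k + Y)) := by gcongr
      _ = A * (K * (d + 1)) ^ w * (q ^ e * q ^ ((n + 1) * (Y + k))) := by
        rw [mul_pow]; ring
      _ ≤ (A + 1) * (C * b ^ Y) * (q ^ e * q ^ ((n + 1) * (Y + k))) := by
        gcongr
        linarith
      _ = _ := by ring
  refine (Finset.sum_le_sum hterm).trans ?_
  rw [Finset.sum_const, nsmul_eq_mul]
  have hcard : ((moduli F Y).card : ℝ) ≤ (Fintype.card F : ℝ) ^ Y := by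
    exact_mod_cast card_moduli_le Y
  refine (mul_le_mul_of_nonneg_right hcard (by positivity)).trans (le_of_eq ?_)
  rw [two_mul, pow_add]
  field_simp

/-- The contribution of the moduli that are larger than the side of the box. -/
lemma exists_sum_min_le {R : MvPolynomial (Fin n) F[X]} (hR : R ≠ 0) (d e : ℕ) {b : ℝ}
    (hb : 1 < b) : ∃ C : ℝ, 0 < C ∧ ∀ M Y : ℕ, M < Y →
      ((∑ x ∈ boxes F n M, min (Fintype.card F ^ M)
        (∑ r ∈ (moduli F Y).filter fun r => r ∣ MvPolynomial.eval x R,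
          (d + 1) ^ (primeFactors r).card * Fintype.card F ^ (e + (M - Y))) : ℕ) : ℝ) ≤
      C * b ^ Y * (Fintype.card F : ℝ) ^ (n * M) := by
  obtain ⟨B, hB⟩ := exists_natDegree_eval_le R
  set β : ℝ := b ^ ((B + 1 : ℝ)⁻¹) with hβ_def
  have hβ : 1 < β := Real.one_lt_rpow hb (by positivity)
  have hβb : β ^ (B + 1) = b := by
    rw [hβ_def, ← Real.rpow_natCast, ← Real.rpow_mul (by linarith)]
    push_cast
    rw [inv_mul_cancel₀ (by positivity), Real.rpow_one]
  obtain ⟨C₂, hC₂, h₂⟩ := exists_pow_card_primeFactors_le F (K := 2) (b := β) (by norm_num) hβ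
  obtain ⟨C₃, hC₃, h₃⟩ := exists_pow_card_primeFactors_le F (K := d + 1) (b := β)
    (by linarith [(Nat.cast_nonneg d : (0 : ℝ) ≤ d)]) hβ
  have hq : (0 : ℝ) < Fintype.card F := by exact_mod_cast Fintype.card_pos
  refine ⟨R.totalDegree + C₂ * C₃ * (Fintype.card F : ℝ) ^ e, by positivity, fun M Y hY => ?_⟩
  rw [← Finset.sum_filter_add_sum_filter_not _ fun x => MvPolynomial.eval x R = 0, Nat.cast_add,
    add_mul, add_mul]
  have hbY : 1 ≤ b ^ Y := one_le_pow₀ hb.le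
  refine add_le_add ?_ ?_
  · have h1 := (Finset.sum_le_sum fun x (_ : x ∈ (boxes F n M).filter fun x =>
      MvPolynomial.eval x R = 0) => min_le_left (Fintype.card F ^ M)
        (∑ r ∈ (moduli F Y).filter fun r => r ∣ MvPolynomial.eval x R,
          (d + 1) ^ (primeFactors r).card * Fintype.card F ^ (e + (M - Y))))
    rw [Finset.sum_const, smul_eq_mul] at h1
    have h2 : (_ : ℝ) ≤ _ := Nat.cast_le.2 (h1.trans (card_eval_eq_zero_mul_le hR M))
    refine h2.trans ?_
    push_cast
    gcongr
    exact le_mul_of_one_le_right (by positivity) hbY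
  · rw [Nat.cast_sum]
    have hterm : ∀ x ∈ (boxes F n M).filter fun x => ¬ MvPolynomial.eval x R = 0,
        ((min (Fintype.card F ^ M)
          (∑ r ∈ (moduli F Y).filter fun r => r ∣ MvPolynomial.eval x R,
            (d + 1) ^ (primeFactors r).card * Fintype.card F ^ (e + (M - Y))) : ℕ) : ℝ) ≤
        C₂ * C₃ * (Fintype.card F : ℝ) ^ e * b ^ Y := by
      intro x hx
      obtain ⟨hx, hx0⟩ := Finset.mem_filter.1 hx
      refine (Nat.cast_le.2 (min_le_right _ _)).trans ?_
      rw [Nat.sub_eq_zero_of_le hY.le, add_zero]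
      push_cast
      have h4 : ∀ r ∈ (moduli F Y).filter fun r => r ∣ MvPolynomial.eval x R,
          ((d : ℝ) + 1) ^ (primeFactors r).card * (Fintype.card F : ℝ) ^ e ≤
            C₃ * β ^ Y * (Fintype.card F : ℝ) ^ e := by
        intro r hr
        have hr' := mem_moduli.1 (Finset.mem_filter.1 hr).1
        have := h₃ r hr'.1.ne_zero
        rw [hr'.2.2] at this
        gcongr
      refine (Finset.sum_le_sum h4).trans ?_
      rw [Finset.sum_const, nsmul_eq_mul]
      have h5 : (((moduli F Y).filter fun r => r ∣ MvPolynomial.eval x R).card : ℝ) ≤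
          C₂ * β ^ (B * Y) := by
        refine le_trans ?_ ((h₂ _ hx0).trans ?_)
        · exact_mod_cast card_squarefree_divisors_le hx0 _ fun r hr => by
            obtain ⟨hr, hdvd⟩ := Finset.mem_filter.1 hr
            exact ⟨(mem_moduli.1 hr).1, (mem_moduli.1 hr).2.1, hdvd⟩
        · have := (hB M x hx).trans (Nat.mul_le_mul_left B hY)
          gcongr
          exact hβ.le
      calc _ ≤ C₂ * β ^ (B * Y) * (C₃ * β ^ Y * (Fintype.card F : ℝ) ^ e) := by gcongr
        _ = C₂ * C₃ * (Fintype.card F : ℝ) ^ e * (β ^ (B + 1)) ^ Y := by ring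
        _ = _ := by rw [hβb]
    refine (Finset.sum_le_sum hterm).trans ?_
    rw [Finset.sum_const, nsmul_eq_mul, mul_comm]
    gcongr
    rw [← Nat.cast_pow, ← card_boxes]
    exact_mod_cast Finset.card_filter_le _ _

/-- The sieve bound over boxes with integral sides. -/
lemma exists_card_common_dvd_le {H₀ H₁ : MvPolynomial (Fin (n + 1)) F[X]} (hH₀ : H₀ ≠ 0)
    (hcop : IsRelPrime (MvPolynomial.map (algebraMap F[X] (RatFunc F)) H₀)
      (MvPolynomial.map (algebraMap F[X] (RatFunc F)) H₁)) {b : ℝ} (hb : 1 < b) :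
    ∃ C : ℝ, 0 < C ∧ ∀ M Y : ℕ,
      (((boxes F (n + 1) M).filter fun c => ∃ r ∈ moduli F Y,
        r ∣ MvPolynomial.eval c H₀ ∧ r ∣ MvPolynomial.eval c H₁).card : ℝ) ≤
      C * b ^ Y * ((Fintype.card F : ℝ) ^ ((n + 1) * M) / (Fintype.card F : ℝ) ^ Y +
        (Fintype.card F : ℝ) ^ (n * M)) := by
  obtain ⟨d, e, s, R, hR, h⟩ := exists_card_common_dvd_le_sum hH₀ hcop
  obtain ⟨C₁, hC₁, h₁⟩ := exists_sum_dvd_eval_le hR d e hb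
  obtain ⟨C₂, hC₂, h₂⟩ := exists_sum_min_le hR d e hb
  have hq : (1 : ℝ) ≤ Fintype.card F := by exact_mod_cast Fintype.card_pos
  set q : ℝ := (Fintype.card F : ℝ)
  refine ⟨C₁ * q ^ ((n + 1) * s) + C₂ * q ^ (n * s), by positivity, fun M Y => ?_⟩
  refine (Nat.cast_le.2 (h M Y)).trans ?_
  have hb0 : (0 : ℝ) < b := by linarith
  obtain hY | hY := le_or_gt Y (M + s)
  · calc _ ≤ _ := Nat.cast_le.2 (Finset.sum_le_sum fun x _ => min_le_right _ _)
      _ ≤ C₁ * b ^ Y * (q ^ ((n + 1) * (M + s)) / q ^ Y) := h₁ _ _ hY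
      _ = C₁ * q ^ ((n + 1) * s) * b ^ Y * (q ^ ((n + 1) * M) / q ^ Y) := by ring
      _ ≤ _ := by
        gcongr
        · exact le_add_of_nonneg_right (by positivity)
        · exact le_add_of_nonneg_right (by positivity)
  · calc _ ≤ C₂ * b ^ Y * q ^ (n * (M + s)) := h₂ _ _ hY
      _ = C₂ * q ^ (n * s) * b ^ Y * q ^ (n * M) := by ring
      _ ≤ _ := by
        gcongr
        · exact le_add_of_nonneg_left (by positivity)
        · exact le_add_of_nonneg_left (by positivity)

/-- The sieve bound over boxes with integral sides, in any number of variables. -/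
lemma exists_card_common_dvd_le_of_isRelPrime {H₀ H₁ : MvPolynomial (Fin n) F[X]}
    (hcop : IsRelPrime (MvPolynomial.map (algebraMap F[X] (RatFunc F)) H₀)
      (MvPolynomial.map (algebraMap F[X] (RatFunc F)) H₁)) {b : ℝ} (hb : 1 < b) :
    ∃ C : ℝ, 0 < C ∧ ∀ M Y : ℕ,
      (((boxes F n M).filter fun c => ∃ r ∈ moduli F Y,
        r ∣ MvPolynomial.eval c H₀ ∧ r ∣ MvPolynomial.eval c H₁).card : ℝ) ≤
      C * b ^ Y * ((Fintype.card F : ℝ) ^ (n * M) / (Fintype.card F : ℝ) ^ Y +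
        (Fintype.card F : ℝ) ^ (n * M) / (Fintype.card F : ℝ) ^ M) := by
  wlog hH₀ : H₀ ≠ 0 generalizing H₀ H₁
  · have hH₁ : H₁ ≠ 0 := by
      rintro rfl
      rw [not_not] at hH₀
      rw [hH₀, map_zero] at hcop
      exact not_isUnit_zero (hcop dvd_rfl dvd_rfl)
    obtain ⟨C, hC, h⟩ := this hcop.symm hH₁
    refine ⟨C, hC, fun M Y => ?_⟩
    simp only [and_comm] at h ⊢
    exact h M Y
  have hq : (1 : ℝ) ≤ Fintype.card F := by exact_mod_cast Fintype.card_pos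
  obtain _ | n := n
  · have h0 : MvPolynomial.eval 0 H₀ ≠ 0 := by
      refine fun h0 => hH₀ (MvPolynomial.funext fun c => ?_)
      rw [Subsingleton.elim c 0, h0, map_zero]
    set D := (MvPolynomial.eval 0 H₀).natDegree with hD
    set q : ℝ := (Fintype.card F : ℝ)
    refine ⟨q ^ D, by positivity, fun M Y => ?_⟩
    have hb0 : (0 : ℝ) < b := by linarith
    obtain h | ⟨c, hc⟩ := ((boxes F 0 M).filter fun c => ∃ r ∈ moduli F Y,
        r ∣ MvPolynomial.eval c H₀ ∧ r ∣ MvPolynomial.eval c H₁).eq_empty_or_nonempty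
    · rw [h, Finset.card_empty, Nat.cast_zero]
      positivity
    · obtain ⟨-, r, hr, hdvd, -⟩ := Finset.mem_filter.1 hc
      rw [Subsingleton.elim c 0] at hdvd
      have hY : Y ≤ D := by
        rw [← (mem_moduli.1 hr).2.2]
        exact natDegree_le_of_dvd hdvd h0
      calc _ ≤ (1 : ℝ) := by exact_mod_cast Finset.card_le_one_of_subsingleton _
        _ = q ^ Y * 1 * (1 / q ^ Y + 0) := by field_simp; simp
        _ ≤ _ := by
          rw [zero_mul, pow_zero]
          gcongr
          · exact one_le_pow₀ hb.le
          · positivity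
  · obtain ⟨C, hC, h⟩ := exists_card_common_dvd_le hH₀ hcop hb
    refine ⟨C, hC, fun M Y => (h M Y).trans (le_of_eq ?_)⟩
    congr 2
    rw [eq_div_iff (by positivity), ← pow_add]
    ring

end CommonDivisors

end EkedahlSieve

/-- Ekedahl/geometric sieve over `F_q[t]`, square-free moduli:
fix `H₀, H₁ ∈ F_q[t][c₁,…,cₙ]` with no common non-unit factor over `F_q(t)`. Then for every
`ε > 0` there is `C > 0` such that for all `T, Y > 0`, the number of `c ∈ F_q[t]^n` with
`max_i |c_i| ≤ q^T` for which some monic square-free `r` with `|r| = q^Y` divides both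
`H₀(c)` and `H₁(c)` is at most `C·q^{Yε}(q^{nT-Y} + q^{(n-1)T})`. -/
theorem ekedahl_sieve_squarefree (Fq : Type*) [Field Fq] [Fintype Fq] (n : ℕ)
    (H₀ H₁ : MvPolynomial (Fin n) (Polynomial Fq))
    (hcop : ∀ d : MvPolynomial (Fin n) (RatFunc Fq),
      d ∣ MvPolynomial.map (algebraMap (Polynomial Fq) (RatFunc Fq)) H₀ →
      d ∣ MvPolynomial.map (algebraMap (Polynomial Fq) (RatFunc Fq)) H₁ → IsUnit d) :
    ∀ ε : ℝ, 0 < ε → ∃ C : ℝ, 0 < C ∧ ∀ T Y : ℝ, 0 < T → 0 < Y →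
      (Set.ncard {c : Fin n → Polynomial Fq |
          (∀ i, polyAbs Fq (c i) ≤ (Fintype.card Fq : ℝ) ^ T) ∧
          ∃ r : Polynomial Fq, r.Monic ∧ Squarefree r ∧ (r.natDegree : ℝ) = Y ∧
            r ∣ MvPolynomial.eval c H₀ ∧ r ∣ MvPolynomial.eval c H₁} : ℝ) ≤
        C * (Fintype.card Fq : ℝ) ^ (Y * ε) *
          ((Fintype.card Fq : ℝ) ^ ((n : ℝ) * T - Y) +
            (Fintype.card Fq : ℝ) ^ (((n : ℝ) - 1) * T)) := by
  intro ε hε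
  have hq : (1 : ℝ) < Fintype.card Fq := by exact_mod_cast Fintype.one_lt_card
  obtain ⟨C, hC, h⟩ := EkedahlSieve.exists_card_common_dvd_le_of_isRelPrime (H₀ := H₀) (H₁ := H₁)
    hcop (Real.one_lt_rpow hq hε)
  set q : ℝ := (Fintype.card Fq : ℝ)
  have hq0 : 0 < q := by linarith
  refine ⟨C * q ^ (n : ℝ), by positivity, fun T Y hT hY => ?_⟩
  by_cases hY' : ∃ m : ℕ, (m : ℝ) = Y
  swap
  · have hempty : {c : Fin n → Polynomial Fq | (∀ i, polyAbs Fq (c i) ≤ q ^ T) ∧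
        ∃ r : Polynomial Fq, r.Monic ∧ Squarefree r ∧ (r.natDegree : ℝ) = Y ∧
          r ∣ MvPolynomial.eval c H₀ ∧ r ∣ MvPolynomial.eval c H₁} = ∅ := by
      refine Set.eq_empty_of_forall_notMem ?_
      rintro c ⟨-, r, -, -, hr, -⟩
      exact hY' ⟨_, hr⟩
    rw [hempty, Set.ncard_empty, Nat.cast_zero]
    positivity
  obtain ⟨Y, rfl⟩ := hY'
  set M := ⌊T⌋₊ + 1 with hM
  have hMT : T ≤ M := by
    rw [hM]
    exact_mod_cast (Nat.lt_floor_add_one T).le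
  have hTM : (M : ℝ) ≤ T + 1 := by
    rw [hM]
    push_cast
    linarith [Nat.floor_le hT.le]
  have hsub : Set.ncard {c : Fin n → Polynomial Fq | (∀ i, polyAbs Fq (c i) ≤ q ^ T) ∧
      ∃ r : Polynomial Fq, r.Monic ∧ Squarefree r ∧ (r.natDegree : ℝ) = Y ∧
        r ∣ MvPolynomial.eval c H₀ ∧ r ∣ MvPolynomial.eval c H₁} ≤
      ((EkedahlSieve.boxes Fq n M).filter fun c => ∃ r ∈ EkedahlSieve.moduli Fq Y,
        r ∣ MvPolynomial.eval c H₀ ∧ r ∣ MvPolynomial.eval c H₁).card := by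
    rw [← Set.ncard_coe_finset]
    refine Set.ncard_le_ncard ?_ (Finset.finite_toSet _)
    rintro c ⟨hc, r, hr, hsq, hdeg, h₀, h₁⟩
    refine Finset.mem_coe.2 (Finset.mem_filter.2 ⟨EkedahlSieve.mem_boxes.2 fun i => ?_, r,
      EkedahlSieve.mem_moduli.2 ⟨hr, hsq, by exact_mod_cast hdeg⟩, h₀, h₁⟩)
    by_cases hci : c i = 0
    · rw [hci, Polynomial.degree_zero]
      exact WithBot.bot_lt_coe _
    · have h2 := hc i
      rw [polyAbs, if_neg hci, ← Real.rpow_natCast, Real.rpow_le_rpow_left_iff hq] at h2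
      rw [Polynomial.degree_eq_natDegree hci]
      exact_mod_cast Nat.lt_succ_of_le (Nat.le_floor h2)
  refine (Nat.cast_le.2 hsub).trans ((h M Y).trans ?_)
  have hY_pow : (q ^ ε) ^ Y = q ^ ((Y : ℝ) * ε) := by
    rw [← Real.rpow_natCast, ← Real.rpow_mul hq0.le, mul_comm]
  have h₁ : q ^ (n * M) / q ^ Y ≤ q ^ (n : ℝ) * q ^ ((n : ℝ) * T - Y) := by
    rw [← Real.rpow_natCast, ← Real.rpow_natCast, ← Real.rpow_sub hq0, ← Real.rpow_add hq0,
      Real.rpow_le_rpow_left_iff hq]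
    push_cast
    nlinarith [(Nat.cast_nonneg n : (0 : ℝ) ≤ n)]
  have h₂ : q ^ (n * M) / q ^ M ≤ q ^ (n : ℝ) * q ^ (((n : ℝ) - 1) * T) := by
    rw [← Real.rpow_natCast, ← Real.rpow_natCast, ← Real.rpow_sub hq0, ← Real.rpow_add hq0,
      Real.rpow_le_rpow_left_iff hq]
    push_cast
    nlinarith [(Nat.cast_nonneg n : (0 : ℝ) ≤ n)]
  calc _ ≤ C * (q ^ ε) ^ Y * (q ^ (n : ℝ) * q ^ ((n : ℝ) * T - Y) +
        q ^ (n : ℝ) * q ^ (((n : ℝ) - 1) * T)) := by gcongr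
    _ = _ := by rw [hY_pow]; ring
end
end
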